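/- (Rogers, lower moment bound) Let n ≥ 2, let r > 0, let ρ: ℝ^n → ℝ be the characteristic function of the closed ball of radius r centered at the origin, and let V(r) be its Lebesgue volume. Let k be a positive integer with n ≥ ⌊k²/4⌋ + 3. Then e^{−V(r)/2} · Σ_{i=0}^{∞} i^k · (V(r)/2)^i / i! ≤ ∫_{X_n} ((1/2) Σ_{x ∈ L∖{0}} ρ(x))^k dμ_n(L); that is, the k-th moment of the number of nonzero lattice vectors up to sign in the ball is at least the k-th moment of the Poisson distribution with mean V(r)/2. -/

import Mathlib

open MeasureTheory Matrix
open scoped Nat Classical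

noncomputable section

abbrev SLR (n : ℕ) := Matrix.SpecialLinearGroup (Fin n) ℝ

instance (n : ℕ) : MeasurableSpace (SLR n) :=
  MeasurableSpace.comap (fun g : SLR n => (g : Matrix (Fin n) (Fin n) ℝ))
    (inferInstanceAs (MeasurableSpace (Fin n → Fin n → ℝ)))

/-- The image of SL_n(ℤ) in SL_n(ℝ), as a subgroup. -/
def SLZ (n : ℕ) : Subgroup (SLR n) :=
  (Matrix.SpecialLinearGroup.map (Int.castRingHom ℝ)).range

/-- The space of lattices `X_n = SL_n(ℤ) \ SL_n(ℝ)` (space of right cosets). -/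
def LatSpace (n : ℕ) := Quotient (QuotientGroup.rightRel (SLZ n))

instance (n : ℕ) : MeasurableSpace (LatSpace n) :=
  inferInstanceAs (MeasurableSpace (Quotient _))

/-- The coset of `g`. -/
def latMk (n : ℕ) (g : SLR n) : LatSpace n :=
  Quotient.mk (QuotientGroup.rightRel (SLZ n)) g

/-- Right translation action of `SL_n(ℝ)` on `X_n`. -/
def rTranslate (n : ℕ) (a : SLR n) (x : LatSpace n) : LatSpace n :=
  Quotient.lift (fun g => latMk n (g * a))
    (fun g g' hgg' => Quotient.sound (QuotientGroup.rightRel_apply.mpr (by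
      have h : g' * g⁻¹ ∈ SLZ n := QuotientGroup.rightRel_apply.mp hgg'
      simpa [_root_.mul_inv_rev, mul_assoc] using h))) x

/-- The lattice `ℤ^n g` associated to `g ∈ SL_n(ℝ)`. -/
def latticeOf (n : ℕ) (g : SLR n) : Set (Fin n → ℝ) :=
  Set.range (fun m : Fin n → ℤ =>
    Matrix.vecMul (fun i => (m i : ℝ)) (g : Matrix (Fin n) (Fin n) ℝ))

/-- `S'`: the set of points of `S` whose first nonzero coordinate is positive. -/
def posHalf (n : ℕ) (S : Set (Fin n → ℝ)) : Set (Fin n → ℝ) :=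
  {x ∈ S | ∃ i : Fin n, 0 < x i ∧ ∀ j < i, x j = 0}

/-- `A` has at least `k` elements. -/
def hasAtLeast {α : Type*} (A : Set α) (k : ℕ) : Prop :=
  ∃ t : Finset α, ↑t ⊆ A ∧ t.card = k

/-- `ρ_{S',h}(L)`: the number of `h`-element subsets of `L ∩ S'`. -/
def rhoSub (n : ℕ) (S : Set (Fin n → ℝ)) (h : ℕ) (g : SLR n) : ℕ :=
  Nat.card {t : Finset (Fin n → ℝ) // ↑t ⊆ latticeOf n g ∩ posHalf n S ∧ t.card = h}

end

section LatticeCounting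

variable {E : Type*} [NormedAddCommGroup E]

/-- The points of `L` in the closed ball of radius `R` about the origin. -/
def latBall (L : AddSubgroup E) (R : ℝ) : Set E := {x | x ∈ L ∧ ‖x‖ ≤ R}

/-- The number of points of `L` in the closed ball of radius `R`. -/
noncomputable def latCount (L : AddSubgroup E) (R : ℝ) : ℕ := (latBall L R).ncard

/-- Every ball contains only finitely many points of `L`. -/
def LocFin (L : AddSubgroup E) : Prop := ∀ R, (latBall L R).Finite

lemma latBall_mono (L : AddSubgroup E) {R S : ℝ} (h : R ≤ S) : latBall L R ⊆ latBall L S :=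
  fun _ hx => ⟨hx.1, hx.2.trans h⟩

lemma latCount_mono {L : AddSubgroup E} (hL : LocFin L) {R S : ℝ} (h : R ≤ S) :
    latCount L R ≤ latCount L S :=
  Set.ncard_le_ncard (latBall_mono L h) (hL S)

/-- If a finite set maps into a finite set with fibres of diameter at most `R`, its size is
bounded through `latCount L R`. -/
lemma card_le_of_fibers {L : AddSubgroup E} (hL : LocFin L) {κ : Type*} {R : ℝ}
    {s : Set E} (hs : s.Finite) (hsL : s ⊆ L) (T : Finset κ) (F : E → κ)
    (hF : ∀ x ∈ s, F x ∈ T)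
    (hdiam : ∀ x ∈ s, ∀ y ∈ s, F x = F y → ‖x - y‖ ≤ R) :
    s.ncard ≤ latCount L R * T.card := by
  classical
  rw [Set.ncard_eq_toFinset_card s hs]
  refine Finset.card_le_mul_card_image_of_maps_to (f := F) (by simpa using hF) _ ?_
  intro b _
  by_cases hne : (hs.toFinset.filter (fun a => F a = b)).Nonempty
  · obtain ⟨y, hy⟩ := hne
    simp only [Finset.mem_filter, Set.Finite.mem_toFinset] at hy
    have : (hs.toFinset.filter (fun a => F a = b)).card
        = ((hs.toFinset.filter (fun a => F a = b)).image (fun x => x - y)).card :=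
      (Finset.card_image_of_injective _ (sub_left_injective)).symm
    rw [this, latCount, ← Set.ncard_coe_finset]
    refine Set.ncard_le_ncard ?_ (hL R)
    intro z hz
    simp only [Finset.coe_image, Finset.coe_filter, Set.Finite.mem_toFinset, Set.mem_image,
      Set.mem_ofPred_eq] at hz
    obtain ⟨x, ⟨hx, hxb⟩, rfl⟩ := hz
    exact ⟨L.sub_mem (hsL hx) (hsL hy.1), hdiam x hx y hy.1 (hxb.trans hy.2.symm)⟩
  · rw [Finset.not_nonempty_iff_eq_empty.1 hne]; simp

variable [InnerProductSpace ℝ E]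

/-- The dimension of the span of the points of `L` in the closed ball of radius `R`. -/
noncomputable def latRank (L : AddSubgroup E) (R : ℝ) : ℕ :=
  Module.finrank ℝ (Submodule.span ℝ (latBall L R))

variable [FiniteDimensional ℝ E]

lemma latRank_mono (L : AddSubgroup E) {R S : ℝ} (h : R ≤ S) :
    latRank L R ≤ latRank L S :=
  Submodule.finrank_mono (Submodule.span_mono (latBall_mono L h))

/-- Comparison of counts at a radius `ρ` and a smaller radius `R`. -/
lemma latCount_cover {L : AddSubgroup E} (hL : LocFin L) {d h : ℕ}
    (hhd : h ≤ d) {ρ R : ℝ} (hR : 0 < R) (hRρ : R ≤ ρ) (hrk : latRank L ρ ≤ h) :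
    (latCount L ρ : ℝ) ≤ (5 * (d + 1)) ^ d * (ρ / R) ^ h * latCount L R := by
  set W := Submodule.span ℝ (latBall L ρ) with hW
  set m := Module.finrank ℝ W with hm
  have hmh : m ≤ h := hrk
  have hρ0 : 0 < ρ := hR.trans_le hRρ
  let b := stdOrthonormalBasis ℝ W
  have hρR : 1 ≤ ρ / R := (one_le_div hR).2 hRρ
  set q : ℕ := ⌈ρ * (d + 1) / R⌉₊ with hq
  have hqle : (q : ℝ) ≤ ρ / R * (d + 1) + 1 := by
    have := (Nat.ceil_lt_add_one (a := ρ * (d + 1) / R) (by positivity)).le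
    calc (q : ℝ) ≤ _ := this
      _ = _ := by ring
  have hq' : ρ * (d + 1) / R ≤ q := Nat.le_ceil _
  let F : E → (Fin m → ℤ) := fun x j => ⌊inner ℝ (b j : E) x * (d + 1) / R⌋
  let T : Finset (Fin m → ℤ) := Fintype.piFinset fun _ => Finset.Icc (-(q : ℤ)) q
  have hbn : ∀ j, ‖(b j : E)‖ = 1 := fun j => by
    rw [← Submodule.coe_norm]; exact b.orthonormal.1 j
  have key := card_le_of_fibers hL (R := R) (hL ρ) (fun x hx => hx.1) T F ?_ ?_
  · have hcard : T.card = (2 * q + 1) ^ m := by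
      simp only [T, Fintype.card_piFinset, Int.card_Icc, Finset.prod_const, Finset.card_univ,
        Fintype.card_fin]
      congr 1
      omega
    rw [hcard] at key
    have h1 : ((2 * q + 1 : ℕ) : ℝ) ≤ 5 * (d + 1) * (ρ / R) := by
      push_cast
      nlinarith [mul_nonneg (Nat.cast_nonneg (α := ℝ) d) (by linarith : 0 ≤ ρ / R)]
    have h2 : ((2 * q + 1 : ℕ) : ℝ) ^ m ≤ (5 * (d + 1)) ^ d * (ρ / R) ^ h := by
      calc ((2 * q + 1 : ℕ) : ℝ) ^ m ≤ (5 * (d + 1) * (ρ / R)) ^ m :=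
            pow_le_pow_left₀ (by positivity) h1 _
        _ = (5 * (d + 1)) ^ m * (ρ / R) ^ m := mul_pow _ _ _
        _ ≤ _ := by
            gcongr
            · have : (0 : ℝ) ≤ d := Nat.cast_nonneg d
              linarith
            · omega
    calc (latCount L ρ : ℝ) ≤ ((latCount L R * (2 * q + 1) ^ m : ℕ) : ℝ) := by exact_mod_cast key
      _ = ((2 * q + 1 : ℕ) : ℝ) ^ m * latCount L R := by push_cast; ring
      _ ≤ _ := by gcongr
  · intro x hx
    simp only [T, Fintype.mem_piFinset, Finset.mem_Icc, F]
    intro j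
    have habs : |inner ℝ (b j : E) x| ≤ ρ := by
      have := abs_real_inner_le_norm (b j : E) x
      rw [hbn, one_mul] at this
      exact this.trans hx.2
    have h3 : |inner ℝ (b j : E) x * (d + 1) / R| ≤ q := by
      rw [abs_div, abs_mul, abs_of_pos hR, abs_of_pos (by positivity : (0 : ℝ) < d + 1)]
      refine le_trans ?_ hq'
      gcongr
    rw [abs_le] at h3
    constructor
    · rw [Int.le_floor]; push_cast; exact h3.1
    · exact_mod_cast (Int.floor_le _).trans h3.2
  · intro x hx y hy hxy
    have hxW : x - y ∈ W := W.sub_mem (Submodule.subset_span hx) (Submodule.subset_span hy)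
    have hsum := b.sum_repr' ⟨x - y, hxW⟩
    have hsum' : ∑ j, inner ℝ (b j : E) (x - y) • (b j : E) = x - y := by
      have := congrArg (Subtype.val) hsum
      simpa using this
    have hc : ∀ j, |inner ℝ (b j : E) (x - y)| ≤ R / (d + 1) := by
      intro j
      have h4 := Int.abs_sub_lt_one_of_floor_eq_floor (congrFun hxy j)
      have h5 : inner ℝ (b j : E) x * (d + 1) / R - inner ℝ (b j : E) y * (d + 1) / R
          = inner ℝ (b j : E) (x - y) * ((d + 1) / R) := by
        rw [inner_sub_right]; ring
      rw [h5, abs_mul, abs_of_pos (by positivity : (0 : ℝ) < (d + 1) / R)] at h4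
      rw [le_div_iff₀ (by positivity)]
      have := h4.le
      rw [← mul_div_assoc, div_le_one hR] at this
      exact this
    rw [← hsum']
    calc _ ≤ ∑ j, ‖inner ℝ (b j : E) (x - y) • (b j : E)‖ := norm_sum_le _ _
      _ ≤ ∑ j : Fin m, R / (d + 1) := by
          refine Finset.sum_le_sum fun j _ => ?_
          rw [norm_smul, hbn, mul_one]; exact hc j
      _ = m * (R / (d + 1)) := by simp
      _ ≤ R := by
          rw [← mul_div_assoc, div_le_iff₀ (by positivity)]
          have : (m : ℝ) ≤ d := by exact_mod_cast hmh.trans hhd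
          nlinarith

/-- Every point of the span of the lattice points in a ball is close to a lattice point. -/
lemma exists_lattice_near (L : AddSubgroup E) {d : ℕ} (hd : Module.finrank ℝ E ≤ d) {ρ : ℝ}
    (hρ : 0 ≤ ρ) {z : E} (hz : z ∈ Submodule.span ℝ (latBall L ρ)) :
    ∃ y ∈ L, ‖z - y‖ ≤ d * ρ := by
  obtain ⟨v, hv, hvspan, -⟩ := Submodule.exists_fun_fin_finrank_span_eq ℝ (latBall L ρ)
  rw [← hvspan, Submodule.mem_span_range_iff_exists_fun] at hz
  obtain ⟨c, rfl⟩ := hz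
  refine ⟨∑ i, ⌊c i⌋ • v i, L.sum_mem fun i _ => L.zsmul_mem (hv i).1 _, ?_⟩
  rw [← Finset.sum_sub_distrib]
  have hfin : ((Module.finrank ℝ (Submodule.span ℝ (latBall L ρ)) : ℕ) : ℝ) ≤ d := by
    exact_mod_cast (Submodule.finrank_le _).trans hd
  calc _ ≤ ∑ i, ‖c i • v i - ⌊c i⌋ • v i‖ := norm_sum_le _ _
    _ ≤ ∑ i : Fin (Module.finrank ℝ (Submodule.span ℝ (latBall L ρ))), ρ := by
        refine Finset.sum_le_sum fun i _ => ?_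
        rw [← Int.cast_smul_eq_zsmul ℝ, ← sub_smul, norm_smul]
        have h1 : ‖c i - ⌊c i⌋‖ ≤ 1 := by
          rw [Int.self_sub_floor, Real.norm_eq_abs, abs_of_nonneg (Int.fract_nonneg _)]
          exact (Int.fract_lt_one _).le
        calc _ ≤ 1 * ρ := mul_le_mul h1 (hv i).2 (norm_nonneg _) zero_le_one
          _ = ρ := one_mul _
    _ ≤ d * ρ := by
        simp only [Finset.sum_const, Finset.card_univ, Fintype.card_fin, nsmul_eq_mul]
        gcongr

lemma latCount_growth {L : AddSubgroup E} (hL : LocFin L) {d h : ℕ}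
    (hd : Module.finrank ℝ E ≤ d) {ρ R : ℝ} (hρ : 0 < ρ) (hRρ : ρ ≤ R) (hrk : h ≤ latRank L ρ) :
    (R / ρ) ^ h * latCount L ρ ≤ (d * (2 * d + 3) + d + 1) ^ d * (latCount L R : ℝ) := by
  set W := Submodule.span ℝ (latBall L ρ) with hW
  have hhd : h ≤ d := hrk.trans ((Submodule.finrank_le W).trans hd)
  set K : ℝ := d * (2 * d + 3) + d + 1 with hK
  have hd0 : (0 : ℝ) ≤ d := Nat.cast_nonneg d
  have hK1 : 1 ≤ K := by rw [hK]; nlinarith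
  have hK0 : 0 < K := by linarith
  have hR0 : 0 < R := hρ.trans_le hRρ
  set q : ℕ := ⌊R / (K * ρ)⌋₊ with hq
  have hqR : R / (K * ρ) ≤ q + 1 := (Nat.lt_floor_add_one _).le
  have main : ((q : ℝ) + 1) ^ h * latCount L ρ ≤ latCount L R := by
    rcases Nat.eq_zero_or_pos q with h0 | h0
    · rw [h0]; simp
      exact latCount_mono hL hRρ
    have hqK : q * (K * ρ) ≤ R := by
      have := Nat.floor_le (a := R / (K * ρ)) (by positivity)
      rwa [le_div_iff₀ (by positivity)] at this
    have hq1 : (1 : ℝ) ≤ q := by exact_mod_cast h0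
    let b := stdOrthonormalBasis ℝ W
    have hbn : ∀ j, ‖(b j : E)‖ = 1 := fun j => by
      rw [← Submodule.coe_norm]; exact b.orthonormal.1 j
    let b' : Fin h → E := fun j => (b (Fin.castLE hrk j) : E)
    have hb' : Orthonormal ℝ b' := by
      have h1 : Orthonormal ℝ (fun j => (b j : E)) := b.orthonormal.comp_linearIsometry W.subtypeₗᵢ
      exact h1.comp _ (Fin.castLE_injective hrk)
    let z : (Fin h → Fin (q + 1)) → E := fun c => ∑ j, (((c j : ℕ) : ℝ) * ((2 * d + 3) * ρ)) • b' j
    have hzW : ∀ c, z c ∈ W := fun c => W.sum_mem fun j _ => W.smul_mem _ (b _).2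
    choose y hyL hyz using fun c => exists_lattice_near L hd hρ.le (hzW c)
    have hzn : ∀ c, ‖z c‖ ≤ d * q * ((2 * d + 3) * ρ) := by
      intro c
      calc _ ≤ ∑ j, ‖(((c j : ℕ) : ℝ) * ((2 * d + 3) * ρ)) • b' j‖ := norm_sum_le _ _
        _ ≤ ∑ j : Fin h, (q : ℝ) * ((2 * d + 3) * ρ) := by
            refine Finset.sum_le_sum fun j _ => ?_
            rw [norm_smul, hb'.1 j, mul_one, Real.norm_eq_abs, abs_of_nonneg (by positivity)]
            gcongr
            exact Nat.lt_succ_iff.1 (c j).2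
        _ ≤ _ := by
            simp only [Finset.sum_const, Finset.card_univ, Fintype.card_fin, nsmul_eq_mul]
            rw [mul_assoc]
            gcongr
    have hsep : ∀ c c', ‖z c - z c'‖ ≤ (2 * d + 2) * ρ → c = c' := by
      intro c c' hcc
      by_contra hne
      obtain ⟨j, hj⟩ := Function.ne_iff.1 hne
      have h1 : inner ℝ (b' j) (z c - z c')
          = (((c j : ℕ) : ℝ) - ((c' j : ℕ) : ℝ)) * ((2 * d + 3) * ρ) := by
        simp only [z, inner_sub_right, hb'.inner_right_fintype]
        ring
      have h2 := abs_real_inner_le_norm (b' j) (z c - z c')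
      rw [hb'.1 j, one_mul, h1, abs_mul, abs_of_pos (by positivity : 0 < (2 * (d : ℝ) + 3) * ρ)]
        at h2
      have h3 : (1 : ℝ) ≤ |((c j : ℕ) : ℝ) - ((c' j : ℕ) : ℝ)| := by
        have h4 : (((c j : ℕ) : ℤ) - ((c' j : ℕ) : ℤ)) ≠ 0 := by
          intro h5
          exact hj (Fin.ext (by omega))
        have := Int.one_le_abs h4
        exact_mod_cast this
      nlinarith [mul_le_mul_of_nonneg_right h3 (by positivity : 0 ≤ (2 * (d : ℝ) + 3) * ρ)]
    let S := (hL ρ).toFinset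
    let G : ((Fin h → Fin (q + 1)) × E) → E := fun p => y p.1 + p.2
    have hcardle : ((Finset.univ : Finset (Fin h → Fin (q + 1))) ×ˢ S).card
        ≤ (hL R).toFinset.card := by
      refine Finset.card_le_card_of_injOn G ?_ ?_
      · rintro ⟨c, x⟩ hp
        simp only [Finset.coe_product, Finset.coe_univ, Set.mem_prod, Set.mem_univ, true_and,
          S, Set.Finite.coe_toFinset] at hp
        simp only [Set.Finite.coe_toFinset]
        refine ⟨L.add_mem (hyL c) hp.1, ?_⟩
        have h1 : ‖y c‖ ≤ ‖z c‖ + d * ρ := by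
          calc ‖y c‖ = ‖z c - (z c - y c)‖ := by rw [sub_sub_cancel]
            _ ≤ _ := (norm_sub_le _ _).trans (by gcongr; exact hyz c)
        calc ‖y c + x‖ ≤ ‖y c‖ + ‖x‖ := norm_add_le _ _
          _ ≤ (d * q * ((2 * d + 3) * ρ) + d * ρ) + ρ := by
              gcongr
              · exact h1.trans (by gcongr; exact hzn c)
              · exact hp.2
          _ ≤ q * (K * ρ) := by
              rw [hK]
              nlinarith [mul_nonneg hd0 hρ.le, mul_le_mul_of_nonneg_right hq1 (mul_nonneg hd0 hρ.le)]
          _ ≤ R := hqK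
      · rintro ⟨c, x⟩ hp ⟨c', x'⟩ hp' hG
        simp only [Finset.coe_product, Finset.coe_univ, Set.mem_prod, Set.mem_univ, true_and,
          S, Set.Finite.coe_toFinset] at hp hp'
        simp only [G] at hG
        have hcc : c = c' := by
          apply hsep
          have : z c - z c' = (z c - y c) - (z c' - y c') + (x' - x) := by
            have : y c - y c' = x' - x := by
              rw [sub_eq_sub_iff_add_eq_add, hG, add_comm]
            rw [← this]; abel
          rw [this]
          calc _ ≤ ‖z c - y c‖ + ‖z c' - y c'‖ + (‖x'‖ + ‖x‖) :=
                (norm_add_le _ _).trans (add_le_add (norm_sub_le _ _) (norm_sub_le _ _))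
            _ ≤ d * ρ + d * ρ + (ρ + ρ) := by
                gcongr
                exacts [hyz c, hyz c', hp'.2, hp.2]
            _ = _ := by ring
        subst hcc
        simpa using hG
    rw [Finset.card_product, ← Set.ncard_eq_toFinset_card _ (hL ρ),
      ← Set.ncard_eq_toFinset_card _ (hL R)] at hcardle
    simp only [Finset.card_univ, Fintype.card_fun, Fintype.card_fin] at hcardle
    exact_mod_cast hcardle
  have h1 : (R / ρ) ^ h ≤ K ^ d * ((q : ℝ) + 1) ^ h := by
    calc (R / ρ) ^ h = (K * (R / (K * ρ))) ^ h := by congr 1; field_simp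
      _ = K ^ h * (R / (K * ρ)) ^ h := mul_pow _ _ _
      _ ≤ _ := by
          exact mul_le_mul (pow_le_pow_right₀ hK1 hhd) (pow_le_pow_left₀ (by positivity) hqR _)
            (by positivity) (by positivity)
  calc _ ≤ K ^ d * ((q : ℝ) + 1) ^ h * latCount L ρ := by gcongr
    _ = K ^ d * (((q : ℝ) + 1) ^ h * latCount L ρ) := by ring
    _ ≤ _ := by gcongr

end LatticeCounting

section Phi

variable {E : Type*} [NormedAddCommGroup E]

/-- The infimum over dyadic radii of the normalised counts `latCount L R / R ^ e`. -/
noncomputable def latPhi (e : ℕ) (L : AddSubgroup E) : ℝ :=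
  ⨅ j : ℤ, (latCount L ((2 : ℝ) ^ j) : ℝ) / ((2 : ℝ) ^ j) ^ e

lemma latPhi_bddBelow (e : ℕ) (L : AddSubgroup E) :
    BddBelow (Set.range fun j : ℤ => (latCount L ((2 : ℝ) ^ j) : ℝ) / ((2 : ℝ) ^ j) ^ e) :=
  ⟨0, by rintro _ ⟨j, rfl⟩; positivity⟩

lemma latPhi_nonneg (e : ℕ) (L : AddSubgroup E) : 0 ≤ latPhi e L :=
  le_ciInf fun j => by positivity

lemma latPhi_le {L : AddSubgroup E} (hL : LocFin L) (e : ℕ) {R : ℝ} (hR : 0 < R) :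
    latPhi e L ≤ 2 ^ e * (latCount L R / R ^ e) := by
  obtain ⟨j, hj1, hj2⟩ := exists_mem_Ico_zpow hR (by norm_num : (1 : ℝ) < 2)
  refine (ciInf_le (latPhi_bddBelow e L) j).trans ?_
  have h2 : (0 : ℝ) < 2 ^ j := by positivity
  have hR2 : R ≤ 2 * 2 ^ j := by
    rw [zpow_add_one₀ (by norm_num)] at hj2; linarith
  rw [div_le_iff₀ (by positivity)]
  calc (latCount L (2 ^ j) : ℝ) ≤ latCount L R := by exact_mod_cast latCount_mono hL hj1
    _ = latCount L R / R ^ e * R ^ e := by field_simp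
    _ ≤ latCount L R / R ^ e * (2 * 2 ^ j) ^ e := by gcongr
    _ = _ := by rw [mul_pow]; ring

lemma le_mul_latPhi {L : AddSubgroup E} {e : ℕ} {a C : ℝ} (hC : 0 < C)
    (h : ∀ R, 0 < R → a ≤ C * (latCount L R / R ^ e)) : a ≤ C * latPhi e L := by
  rw [← div_le_iff₀' hC]
  refine le_ciInf fun j => ?_
  rw [div_le_iff₀' hC]
  exact h _ (by positivity)

lemma exists_latBall_trivial {L : AddSubgroup E} (hL : LocFin L) :
    ∃ R : ℝ, 0 < R ∧ latBall L R = {0} := by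
  have hfin : ((latBall L 1) \ {0}).Finite := (hL 1).subset Set.sdiff_subset
  obtain ⟨δ, hδ, hmin⟩ : ∃ δ : ℝ, 0 < δ ∧ ∀ x ∈ (latBall L 1) \ {0}, δ ≤ ‖x‖ := by
    by_cases hne : ((latBall L 1) \ {0}).Nonempty
    · obtain ⟨x, hx, hxm⟩ := Set.exists_min_image _ (fun x => ‖x‖) hfin hne
      exact ⟨‖x‖, norm_pos_iff.2 hx.2, hxm⟩
    · exact ⟨1, one_pos, fun x hx => (hne ⟨x, hx⟩).elim⟩
  refine ⟨min 1 (δ / 2), by positivity, ?_⟩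
  ext x
  simp only [Set.mem_singleton_iff]
  constructor
  · intro hx
    by_contra h0
    have h1 := hmin x ⟨latBall_mono L (min_le_left _ _) hx, h0⟩
    have h2 := hx.2.trans (min_le_right _ _)
    linarith
  · rintro rfl
    exact ⟨L.zero_mem, by simp; positivity⟩

lemma latPhi_zero_le {L : AddSubgroup E} (hL : LocFin L) : latPhi 0 L ≤ 1 := by
  obtain ⟨R, hR, h⟩ := exists_latBall_trivial hL
  have := latPhi_le hL 0 hR
  simpa [latCount, h] using this

variable [InnerProductSpace ℝ E] [FiniteDimensional ℝ E]

/-- The constant of the comparison between a count and an infimum of normalised counts. -/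
noncomputable def latConst (d : ℕ) : ℝ := (5 * (d + 1)) ^ d + (d * (2 * d + 3) + d + 1) ^ d

lemma one_le_latConst (d : ℕ) : 1 ≤ latConst d := by
  have h1 : (1 : ℝ) ≤ (5 * (d + 1)) ^ d := one_le_pow₀ (by
    have : (0 : ℝ) ≤ d := Nat.cast_nonneg d
    linarith)
  have h2 : (0 : ℝ) ≤ (d * (2 * d + 3) + d + 1) ^ d := by positivity
  rw [latConst]; linarith

lemma latCount_div_le_latPhi {L : AddSubgroup E} (hL : LocFin L) {d e : ℕ}
    (hd : Module.finrank ℝ E ≤ d) (he : e ≤ d) {ρ₁ ρ₂ : ℝ} (h1 : 0 < ρ₁) (h12 : ρ₁ ≤ ρ₂)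
    (hr1 : latRank L ρ₁ ≤ e) (hr2 : e ≤ latRank L ρ₂) :
    latCount L ρ₁ / ρ₂ ^ e ≤ latConst d * latPhi e L := by
  have hC := one_le_latConst d
  refine le_mul_latPhi (by linarith) fun R hR => ?_
  have h2 : 0 < ρ₂ := h1.trans_le h12
  rw [div_le_iff₀ (by positivity)]
  rcases le_total R ρ₁ with hc | hc
  · have h := latCount_cover hL he hR hc hr1
    calc (latCount L ρ₁ : ℝ) ≤ (5 * (d + 1)) ^ d * (ρ₁ / R) ^ e * latCount L R := h
      _ ≤ latConst d * (ρ₂ / R) ^ e * latCount L R := by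
          gcongr
          rw [latConst]
          have h2 : (0 : ℝ) ≤ (d * (2 * d + 3) + d + 1) ^ d := by positivity
          linarith
      _ = _ := by rw [div_pow]; ring
  rcases le_total R ρ₂ with hc' | hc'
  · calc (latCount L ρ₁ : ℝ) ≤ 1 * (latCount L R / R ^ e) * R ^ e := by
          rw [one_mul, div_mul_cancel₀ _ (by positivity)]
          exact_mod_cast latCount_mono hL hc
      _ ≤ _ := by gcongr
  · have h := latCount_growth hL hd h2 hc' hr2
    have h3 : (latCount L ρ₁ : ℝ) ≤ latCount L ρ₂ := by exact_mod_cast latCount_mono hL h12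
    calc (latCount L ρ₁ : ℝ) ≤ (ρ₂ / R) ^ e * ((R / ρ₂) ^ e * latCount L ρ₂) := by
          rw [← mul_assoc, ← mul_pow, div_mul_div_cancel₀ hR.ne', div_self h2.ne', one_pow, one_mul]
          exact h3
      _ ≤ (ρ₂ / R) ^ e * (latConst d * latCount L R) := by
          gcongr (ρ₂ / R) ^ e * ?_
          refine h.trans ?_
          gcongr
          rw [latConst]
          have h2 : (0 : ℝ) ≤ (5 * (d + 1)) ^ d := by positivity
          linarith
      _ = _ := by rw [div_pow]; ring

/-- A scale at which the successive minimum number `i` is visible. -/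
lemma exists_scale {L : AddSubgroup E} (hL : LocFin L) {i : ℕ} (hi : 1 ≤ i)
    (hspan : ∃ R, i ≤ latRank L R) :
    ∃ ρ : ℝ, 0 < ρ ∧ i ≤ latRank L ρ ∧ latRank L (ρ / 4) < i := by
  obtain ⟨δ, hδ, h0⟩ := exists_latBall_trivial hL
  obtain ⟨j₀, hj₀, -⟩ := exists_mem_Ico_zpow hδ (by norm_num : (1 : ℝ) < 4)
  have hbdd : ∃ b : ℤ, ∀ z : ℤ, i ≤ latRank L ((4 : ℝ) ^ z) → b ≤ z := by
    refine ⟨j₀, fun z hz => ?_⟩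
    by_contra! hlt
    have h1 : (4 : ℝ) ^ z ≤ δ :=
      (zpow_le_zpow_right₀ (by norm_num) hlt.le).trans hj₀
    have h2 := hz.trans (latRank_mono L h1)
    rw [latRank, h0, Submodule.span_zero_singleton, finrank_bot] at h2
    omega
  have hex : ∃ z : ℤ, i ≤ latRank L ((4 : ℝ) ^ z) := by
    obtain ⟨R, hR⟩ := hspan
    obtain ⟨m, hm⟩ := pow_unbounded_of_one_lt R (by norm_num : (1 : ℝ) < 4)
    exact ⟨m, hR.trans (latRank_mono L (by rw [zpow_natCast]; exact hm.le))⟩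
  obtain ⟨z, hz, hmin⟩ := Int.exists_least_of_bdd hbdd hex
  refine ⟨4 ^ z, by positivity, hz, ?_⟩
  by_contra! hc
  have := hmin (z - 1) (by rwa [zpow_sub_one₀ (by norm_num), ← div_eq_mul_inv])
  omega

lemma latCount_le_latPhi {L : AddSubgroup E} (hL : LocFin L) {r : ℝ} (hr : 0 < r) :
    (latCount L r : ℝ) ≤ latConst (Module.finrank ℝ E) * r ^ latRank L r *
      latPhi (latRank L r) L := by
  have := latCount_div_le_latPhi hL (e := latRank L r) le_rfl (Submodule.finrank_le _) hr le_rfl le_rfl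
    (le_refl (latRank L r))
  rw [div_le_iff₀ (by positivity)] at this
  linarith

/-- If the ranks at scales `ρ / 4` and `K * ρ` differ by at least two, then `latPhi i` is
controlled by its neighbours. -/
lemma latPhi_sq_le {L : AddSubgroup E} (hL : LocFin L) {d i : ℕ}
    (hd : Module.finrank ℝ E ≤ d) (hi : 1 ≤ i) (hid : i + 1 ≤ d) {ρ K : ℝ} (hρ : 0 < ρ)
    (hK : 1 ≤ K) (h1 : i ≤ latRank L ρ) (h2 : latRank L (ρ / 4) < i)
    (h3 : i + 1 ≤ latRank L (K * ρ)) :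
    latPhi i L ^ 2 ≤ (8 ^ i * latConst d) ^ 2 * K ^ (i + 1) *
      (latPhi (i - 1) L * latPhi (i + 1) L) := by
  have hC := one_le_latConst d
  have ha := latPhi_le hL i (by positivity : 0 < ρ / 4)
  have hb := latCount_div_le_latPhi hL hd (e := i - 1) (by omega) (by positivity : 0 < ρ / 4)
    (by linarith : ρ / 4 ≤ ρ) (by omega) (by omega)
  have hc := latCount_div_le_latPhi hL hd hid (by positivity : 0 < ρ / 4)
    (by nlinarith : ρ / 4 ≤ K * ρ) (by omega) h3
  set N : ℝ := (latCount L (ρ / 4) : ℝ)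
  have hN : 0 ≤ N := Nat.cast_nonneg _
  obtain ⟨i, rfl⟩ : ∃ i', i = i' + 1 := ⟨i - 1, by omega⟩
  simp only [Nat.add_sub_cancel] at hb ⊢
  calc latPhi (i + 1) L ^ 2 ≤ (2 ^ (i + 1) * (N / (ρ / 4) ^ (i + 1))) ^ 2 := by
        gcongr; exact latPhi_nonneg _ _
    _ = (8 ^ (i + 1)) ^ 2 * K ^ (i + 1 + 1) * (N / ρ ^ i * (N / (K * ρ) ^ (i + 1 + 1))) := by
        have h8 : (8 : ℝ) ^ (i + 1) = 2 ^ (i + 1) * 4 ^ (i + 1) := by rw [← mul_pow]; norm_num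
        have h4 : (4 : ℝ) ^ (i + 1) ≠ 0 := by positivity
        rw [h8, mul_pow K ρ, div_pow]
        generalize (2 : ℝ) ^ (i + 1) = a
        generalize (4 : ℝ) ^ (i + 1) = b at h4
        field_simp
        ring
    _ ≤ (8 ^ (i + 1)) ^ 2 * K ^ (i + 1 + 1) *
          ((latConst d * latPhi i L) * (latConst d * latPhi (i + 1 + 1) L)) := by
        gcongr
        exact mul_nonneg (by linarith) (latPhi_nonneg _ _)
    _ = _ := by ring

end Phi

section Contraction

variable {E : Type*} [NormedAddCommGroup E] [InnerProductSpace ℝ E]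

/-- The coefficient of `ξ` removed by `contr`. -/
noncomputable def contrCoeff (τ : ℝ) (e ξ w : E) : ℝ := (1 - τ) / inner ℝ e ξ * inner ℝ e w

/-- The linear map which multiplies the direction `ξ` by `t * τ` and the hyperplane `eᗮ`
by `t`. -/
noncomputable def contr (t τ : ℝ) (e ξ : E) : E →ₗ[ℝ] E where
  toFun w := t • (w - contrCoeff τ e ξ w • ξ)
  map_add' v w := by
    rw [← smul_add]
    congr 1
    simp only [contrCoeff, inner_add_right, mul_add, add_smul]
    abel
  map_smul' c w := by
    simp only [contrCoeff, inner_smul_right, RingHom.id_apply]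
    module

lemma contr_apply (t τ : ℝ) (e ξ w : E) :
    contr t τ e ξ w = t • (w - contrCoeff τ e ξ w • ξ) := rfl

variable {t τ : ℝ} {e ξ : E} (ht : 0 < t) (hτ : 0 < τ) (hτ1 : τ ≤ 1) (he : ‖e‖ = 1)
  (heξ : 1 ≤ inner ℝ e ξ) (hξ : ‖ξ‖ ≤ 4)

include ht hτ hτ1 he heξ in
lemma abs_contrCoeff_le (w : E) : |contrCoeff τ e ξ w| ≤ ‖contr t τ e ξ w‖ / t / τ := by
  have h1 : inner ℝ e (contr t τ e ξ w) = t * τ * inner ℝ e w := by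
    have h0 : inner ℝ e ξ ≠ 0 := by linarith
    rw [contr_apply, contrCoeff, inner_smul_right, inner_sub_right, inner_smul_right]
    field_simp
    ring
  have h2 := abs_real_inner_le_norm e (contr t τ e ξ w)
  rw [he, one_mul, h1, abs_mul, abs_of_pos (mul_pos ht hτ)] at h2
  have h3 : |(1 - τ) / inner ℝ e ξ| ≤ 1 := by
    rw [abs_of_nonneg (div_nonneg (by linarith) (by linarith)), div_le_one (by linarith)]
    linarith
  rw [div_div, le_div_iff₀ (mul_pos ht hτ), contrCoeff, abs_mul]
  nlinarith [mul_le_mul_of_nonneg_right h3 (mul_nonneg (abs_nonneg (inner ℝ e w))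
    (mul_pos ht hτ).le)]

include ht in
lemma norm_sub_contrCoeff_smul (w : E) :
    ‖w - contrCoeff τ e ξ w • ξ‖ = ‖contr t τ e ξ w‖ / t := by
  rw [contr_apply, norm_smul, Real.norm_eq_abs, abs_of_pos ht]
  field_simp

include ht hτ hτ1 he heξ hξ in
lemma norm_le_contr (w : E) : ‖w‖ ≤ 5 / (t * τ) * ‖contr t τ e ξ w‖ := by
  have h1 := abs_contrCoeff_le ht hτ hτ1 he heξ w
  have h2 := norm_sub_contrCoeff_smul (τ := τ) (e := e) (ξ := ξ) ht w
  set u := ‖contr t τ e ξ w‖ / t with hu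
  have hu0 : 0 ≤ u := by positivity
  have h3 : ‖w‖ ≤ u + u / τ * 4 := by
    calc ‖w‖ = ‖(w - contrCoeff τ e ξ w • ξ) + contrCoeff τ e ξ w • ξ‖ := by
          rw [sub_add_cancel]
      _ ≤ _ := norm_add_le _ _
      _ ≤ _ := by
          rw [h2, norm_smul, Real.norm_eq_abs]
          gcongr
  have h4 : u ≤ u / τ := by
    rw [le_div_iff₀ hτ]; nlinarith
  calc ‖w‖ ≤ 5 * (u / τ) := by linarith
    _ = _ := by rw [hu]; field_simp

include ht hτ hτ1 he heξ hξ in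
lemma contr_injective : Function.Injective (contr t τ e ξ) := by
  rw [injective_iff_map_eq_zero]
  intro w hw
  have := norm_le_contr ht hτ hτ1 he heξ hξ w
  rw [hw, norm_zero, mul_zero] at this
  exact norm_le_zero_iff.1 this

/-- The image of a lattice under `contr`. -/
noncomputable def contrLat (t τ : ℝ) (e ξ : E) (L : AddSubgroup E) : AddSubgroup E :=
  L.map (contr t τ e ξ).toAddMonoidHom

lemma latBall_contrLat (L : AddSubgroup E) (R : ℝ) :
    latBall (contrLat t τ e ξ L) R = contr t τ e ξ '' {w ∈ L | ‖contr t τ e ξ w‖ ≤ R} := by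
  ext x
  constructor
  · rintro ⟨⟨w, hw, rfl⟩, hR⟩
    exact ⟨w, ⟨hw, hR⟩, rfl⟩
  · rintro ⟨w, ⟨hw, hR⟩, rfl⟩
    exact ⟨⟨w, hw, rfl⟩, hR⟩

include ht hτ hτ1 he heξ hξ in
lemma subset_latBall_of_contr (L : AddSubgroup E) (R : ℝ) :
    {w | w ∈ L ∧ ‖contr t τ e ξ w‖ ≤ R} ⊆ latBall L (5 / (t * τ) * R) := fun w hw =>
  ⟨hw.1, (norm_le_contr ht hτ hτ1 he heξ hξ w).trans (by gcongr; exact hw.2)⟩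

include ht hτ hτ1 he heξ hξ in
lemma LocFin.contrLat {L : AddSubgroup E} (hL : LocFin L) : LocFin (contrLat t τ e ξ L) := by
  intro R
  rw [latBall_contrLat]
  exact ((hL _).subset (subset_latBall_of_contr ht hτ hτ1 he heξ hξ L R)).image _

include ht hτ hτ1 he heξ hξ in
lemma latCount_contrLat (L : AddSubgroup E) (R : ℝ) :
    latCount (contrLat t τ e ξ L) R = {w | w ∈ L ∧ ‖contr t τ e ξ w‖ ≤ R}.ncard := by
  rw [latCount, latBall_contrLat,
    Set.ncard_image_of_injective _ (contr_injective ht hτ hτ1 he heξ hξ)]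

include ht hτ hτ1 he heξ hξ in
lemma latPhi_contrLat_le {L : AddSubgroup E} (hL : LocFin L) (i : ℕ) :
    latPhi i (contrLat t τ e ξ L) ≤ (2 * (5 / (t * τ))) ^ i * latPhi i L := by
  refine le_mul_latPhi (by positivity) fun R hR => ?_
  have hs : 0 < 5 / (t * τ) := by positivity
  set s := 5 / (t * τ) with hsdef
  have h1 := latPhi_le (hL.contrLat ht hτ hτ1 he heξ hξ) i (by positivity : 0 < R / s)
  refine h1.trans ?_
  have h2 : latCount (contrLat t τ e ξ L) (R / s) ≤ latCount L R := by
    rw [latCount_contrLat ht hτ hτ1 he heξ hξ]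
    refine Set.ncard_le_ncard ?_ (hL R)
    have := subset_latBall_of_contr ht hτ hτ1 he heξ hξ L (R / s)
    rwa [← hsdef, mul_div_cancel₀ _ hs.ne'] at this
  calc 2 ^ i * (latCount (contrLat t τ e ξ L) (R / s) / (R / s) ^ i)
      ≤ 2 ^ i * (latCount L R / (R / s) ^ i) := by gcongr
    _ = _ := by rw [mul_pow, div_pow]; field_simp

include ht hτ hτ1 he heξ hξ in
lemma latCount_contrLat_le {L : AddSubgroup E} (hL : LocFin L) {R M : ℝ} (hR : 0 < R)
    (hM : 0 < M) (hM4 : M ≤ 4)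
    (h : ∀ w ∈ L, ‖contr t τ e ξ w‖ ≤ R → |contrCoeff τ e ξ w| * M ≤ R / t) :
    (latCount (contrLat t τ e ξ L) R : ℝ) ≤ 20 / M * latCount L (3 * (R / t)) := by
  set u := R / t with hu
  have hu0 : 0 < u := by positivity
  set q : ℕ := ⌈4 / M⌉₊ with hq
  have hq1 : (q : ℝ) ≤ 4 / M + 1 := (Nat.ceil_lt_add_one (by positivity)).le
  have hq2 : 4 / M ≤ q := Nat.le_ceil _
  have key := card_le_of_fibers hL (R := 3 * u) (s := {w | w ∈ L ∧ ‖contr t τ e ξ w‖ ≤ R})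
    ((hL _).subset (subset_latBall_of_contr ht hτ hτ1 he heξ hξ L R)) (fun x hx => hx.1)
    (Finset.Icc (-(q : ℤ)) q) (fun w => ⌊contrCoeff τ e ξ w * 4 / u⌋) ?_ ?_
  · rw [latCount_contrLat ht hτ hτ1 he heξ hξ]
    have hcard : ((Finset.Icc (-(q : ℤ)) q).card : ℝ) ≤ 20 / M := by
      have : (Finset.Icc (-(q : ℤ)) q).card = 2 * q + 1 := by
        rw [Int.card_Icc]; omega
      rw [this]
      push_cast
      have h3 : 1 ≤ 4 / M := (one_le_div hM).2 hM4
      have h4 : 20 / M = 5 * (4 / M) := by ring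
      linarith
    calc _ ≤ ((latCount L (3 * u) * (Finset.Icc (-(q : ℤ)) q).card : ℕ) : ℝ) := by
          exact_mod_cast key
      _ = (Finset.Icc (-(q : ℤ)) q).card * (latCount L (3 * u) : ℝ) := by push_cast; ring
      _ ≤ _ := by gcongr
  · intro w hw
    have h1 : |contrCoeff τ e ξ w * 4 / u| ≤ q := by
      rw [abs_div, abs_mul, abs_of_pos hu0]
      refine le_trans ?_ hq2
      rw [div_le_div_iff₀ hu0 hM, abs_of_pos (by norm_num : (0 : ℝ) < 4)]
      have := h w hw.1 hw.2
      linarith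
    rw [abs_le] at h1
    rw [Finset.mem_Icc]
    constructor
    · rw [Int.le_floor]; push_cast; exact h1.1
    · exact_mod_cast (Int.floor_le _).trans h1.2
  · intro w hw w' hw' hww
    have h4 := Int.abs_sub_lt_one_of_floor_eq_floor hww
    have h5 : |contrCoeff τ e ξ w - contrCoeff τ e ξ w'| ≤ u / 4 := by
      rw [← sub_div, ← sub_mul, abs_div, abs_mul, abs_of_pos hu0, div_lt_one hu0,
        abs_of_pos (by norm_num : (0 : ℝ) < 4)] at h4
      linarith
    have h6 : ∀ v, ‖contr t τ e ξ v‖ ≤ R → ‖v - contrCoeff τ e ξ v • ξ‖ ≤ u := fun v hv => by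
      rw [norm_sub_contrCoeff_smul ht, hu]; gcongr
    calc ‖w - w'‖ = ‖(w - contrCoeff τ e ξ w • ξ) - (w' - contrCoeff τ e ξ w' • ξ)
          + (contrCoeff τ e ξ w - contrCoeff τ e ξ w') • ξ‖ := by
          congr 1; rw [sub_smul]; abel
      _ ≤ (u + u) + u / 4 * 4 := by
          refine (norm_add_le _ _).trans (add_le_add ((norm_sub_le _ _).trans
            (add_le_add (h6 _ hw.2) (h6 _ hw'.2))) ?_)
          rw [norm_smul, Real.norm_eq_abs]
          gcongr
      _ = 3 * u := by ring

variable [FiniteDimensional ℝ E]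

include ht hτ hτ1 he heξ hξ in
/-- If the span of the lattice points of norm at most `ρ / (2 * τ)` has dimension `i`, then
`contr` decreases `latPhi i` as soon as `ξ` is away from that span. -/
lemma latPhi_contrLat_le_of_gap {L : AddSubgroup E} (hL : LocFin L) {d i : ℕ}
    (hd : Module.finrank ℝ E ≤ d) (hid : i ≤ d) {ρ : ℝ} (hρ : 0 < ρ)
    (h1 : i ≤ latRank L ρ) (h2 : latRank L (ρ / 4) < i)
    {V : Submodule ℝ E} (hV : V = Submodule.span ℝ (latBall L (ρ / (2 * τ)))) :
    latPhi i (contrLat t τ e ξ L) ≤ 20 * 24 ^ i * latConst d *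
      (t⁻¹ ^ i * (max ‖Vᗮ.starProjection ξ‖ τ)⁻¹) * latPhi i L := by
  set M := max ‖Vᗮ.starProjection ξ‖ τ with hMdef
  have hM : 0 < M := hτ.trans_le (le_max_right _ _)
  have hM4 : M ≤ 4 := max_le ((Submodule.norm_starProjection_apply_le _ _).trans hξ) (by linarith)
  have hR : 0 < t * ρ / 12 := by positivity
  have hRt : t * ρ / 12 / t = ρ / 12 := by field_simp
  have key := latCount_contrLat_le ht hτ hτ1 he heξ hξ hL hR hM hM4 ?_
  · have h3 := latPhi_le (hL.contrLat ht hτ hτ1 he heξ hξ) i hR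
    have h4 := latCount_div_le_latPhi hL hd hid (by positivity : 0 < ρ / 4)
      (by linarith : ρ / 4 ≤ ρ) h2.le h1
    rw [hRt, show 3 * (ρ / 12) = ρ / 4 by ring] at key
    refine h3.trans ?_
    calc 2 ^ i * (latCount (contrLat t τ e ξ L) (t * ρ / 12) / (t * ρ / 12) ^ i)
        ≤ 2 ^ i * ((20 / M * latCount L (ρ / 4)) / (t * ρ / 12) ^ i) := by gcongr
      _ = 20 * 24 ^ i * (t⁻¹ ^ i * M⁻¹) * (latCount L (ρ / 4) / ρ ^ i) := by
          rw [show (24 : ℝ) = 2 * 12 by norm_num, mul_pow, div_pow, mul_pow, inv_pow]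
          field_simp
      _ ≤ 20 * 24 ^ i * (t⁻¹ ^ i * M⁻¹) * (latConst d * latPhi i L) := by gcongr
      _ = _ := by ring
  · intro w hw hwR
    rw [hRt]
    have hn := norm_sub_contrCoeff_smul (τ := τ) (e := e) (ξ := ξ) ht w
    have hn' : ‖contr t τ e ξ w‖ / t ≤ ρ / 12 := by rw [← hRt]; gcongr
    have hwV : w ∈ V := by
      rw [hV]
      refine Submodule.subset_span (latBall_mono L ?_
        (subset_latBall_of_contr ht hτ hτ1 he heξ hξ L _ ⟨hw, hwR⟩))
      rw [show 5 / (t * τ) * (t * ρ / 12) = 5 / 12 * (ρ / τ) by field_simp,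
        show ρ / (2 * τ) = 1 / 2 * (ρ / τ) by field_simp]
      exact mul_le_mul_of_nonneg_right (by norm_num) (by positivity)
    rw [hMdef, mul_max_of_nonneg _ _ (abs_nonneg _)]
    refine max_le ?_ ?_
    · have hP : Vᗮ.starProjection (w - contrCoeff τ e ξ w • ξ)
          = -(contrCoeff τ e ξ w • Vᗮ.starProjection ξ) := by
        rw [map_sub, map_smul,
          Submodule.starProjection_apply_eq_zero_iff Vᗮ |>.2 (V.le_orthogonal_orthogonal hwV), zero_sub]
      have h5 := Submodule.norm_starProjection_apply_le Vᗮ (w - contrCoeff τ e ξ w • ξ)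
      rw [hP, norm_neg, norm_smul, Real.norm_eq_abs] at h5
      exact h5.trans (hn.le.trans hn')
    · have h5 := abs_contrCoeff_le ht hτ hτ1 he heξ w
      rw [le_div_iff₀ hτ] at h5
      exact h5.trans hn'

end Contraction

section NegativePowers

/-- A truncated negative power on the interval `[-4, 4]`. -/
noncomputable def truncPow (β τ : ℝ) : ℝ → ℝ :=
  (Set.Icc (-4 : ℝ) 4).indicator fun y => 4 * max |y| τ ^ (-β)

lemma truncPow_nonneg {β τ : ℝ} (hτ : 0 < τ) (y : ℝ) : 0 ≤ truncPow β τ y :=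
  Set.indicator_nonneg (fun _ _ => by positivity) _

lemma continuous_max_rpow {X : Type*} [TopologicalSpace X] {f : X → ℝ} (hf : Continuous f)
    {τ : ℝ} (hτ : 0 < τ) (s : ℝ) : Continuous fun x => max (f x) τ ^ s :=
  (hf.max continuous_const).rpow_const fun _ => Or.inl (hτ.trans_le (le_max_right _ _)).ne'

lemma integrable_truncPow (β : ℝ) {τ : ℝ} (hτ : 0 < τ) : Integrable (truncPow β τ) := by
  refine IntegrableOn.integrable_indicator ?_ measurableSet_Icc
  exact (continuous_const.mul
    (continuous_max_rpow continuous_abs hτ _)).continuousOn.integrableOn_Icc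

lemma integral_truncPow_le {β : ℝ} (hβ : 0 < β) (hβ1 : β < 1) {τ : ℝ} (hτ : 0 < τ) :
    ∫ y, truncPow β τ y ≤ 8 * ∫ x in Set.Ioc (0 : ℝ) 4, x ^ (-β) := by
  have hev : truncPow β τ
      = fun y => (Set.Iic (4 : ℝ)).indicator (fun x => 4 * max x τ ^ (-β)) |y| := by
    funext y
    simp only [truncPow, Set.indicator, Set.mem_Icc, Set.mem_Iic, abs_le]
  have hI : IntegrableOn (fun x : ℝ => x ^ (-β)) (Set.Ioc (0 : ℝ) 4) :=
    (intervalIntegrable_iff_integrableOn_Ioc_of_le (by norm_num)).1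
      (intervalIntegral.intervalIntegrable_rpow' (by linarith))
  rw [hev, integral_comp_abs (f := (Set.Iic (4 : ℝ)).indicator (fun x => 4 * max x τ ^ (-β))),
    setIntegral_indicator measurableSet_Iic, Set.Ioi_inter_Iic, integral_const_mul]
  have hle : ∫ x in Set.Ioc (0 : ℝ) 4, max x τ ^ (-β) ≤ ∫ x in Set.Ioc (0 : ℝ) 4, x ^ (-β) := by
    refine setIntegral_mono_on ?_ hI measurableSet_Ioc fun x hx => ?_
    · exact ((continuous_max_rpow continuous_id hτ _).continuousOn.integrableOn_Icc).mono_set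
        Set.Ioc_subset_Icc_self
    · exact Real.rpow_le_rpow_of_nonpos hx.1 (le_max_left _ _) (by linarith)
  linarith

variable {n : ℕ}

local notation "𝔼" => EuclideanSpace ℝ (Fin n)

lemma setIntegral_prod_max_rpow_le {β : ℝ} (hβ : 0 < β) (hβ1 : β < 1) {τ : ℝ} (hτ : 0 < τ)
    (hτ1 : τ ≤ 1) {p : 𝔼} (hp : ‖p‖ ≤ 3) (b : OrthonormalBasis (Fin n) ℝ 𝔼)
    (S : Finset (Fin n)) :
    ∫ x in Metric.closedBall p 1, ∏ j ∈ S, max |inner ℝ (b j) x| τ ^ (-β)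
      ≤ (8 * ∫ x in Set.Ioc (0 : ℝ) 4, x ^ (-β)) ^ n := by
  set F : (Fin n → ℝ) → ℝ := fun y => ∏ j, truncPow β τ (y j) with hF
  have hFint : Integrable F := Integrable.fintype_prod fun _ => integrable_truncPow β hτ
  have hF0 : ∀ y, 0 ≤ F y := fun y => Finset.prod_nonneg fun _ _ => truncPow_nonneg hτ _
  have hmp : MeasurePreserving (fun x : 𝔼 => WithLp.ofLp (b.repr x)) volume volume :=
    (PiLp.volume_preserving_ofLp (Fin n)).comp b.measurePreserving_repr
  have hGint : Integrable (fun x : 𝔼 => F (WithLp.ofLp (b.repr x))) :=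
    hmp.integrable_comp_of_integrable hFint
  have hemb : MeasurableEmbedding (fun x : 𝔼 => WithLp.ofLp (b.repr x)) :=
    (MeasurableEquiv.toLp 2 (Fin n → ℝ)).symm.measurableEmbedding.comp
      b.repr.toHomeomorph.measurableEmbedding
  have hxb : ∀ x ∈ Metric.closedBall p 1, ∀ j, |inner ℝ (b j) x| ≤ 4 := by
    intro x hx j
    have h1 := abs_real_inner_le_norm (b j) x
    rw [b.orthonormal.1 j, one_mul] at h1
    have h2 : ‖x‖ ≤ ‖x - p‖ + ‖p‖ := by simpa using norm_add_le (x - p) p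
    rw [Metric.mem_closedBall, dist_eq_norm] at hx
    linarith
  calc _ ≤ ∫ x in Metric.closedBall p 1, F (WithLp.ofLp (b.repr x)) := by
        refine setIntegral_mono_on ?_ hGint.integrableOn Metric.isClosed_closedBall.measurableSet
          fun x hx => ?_
        · refine ContinuousOn.integrableOn_compact (isCompact_closedBall _ _)
            (Continuous.continuousOn ?_)
          exact continuous_finsetProd _ fun j _ =>
            continuous_max_rpow (continuous_const.inner continuous_id).abs hτ _
        · have h4 : ∀ j, truncPow β τ (WithLp.ofLp (b.repr x) j)
              = 4 * max |inner ℝ (b j) x| τ ^ (-β) := by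
            intro j
            rw [b.repr_apply_apply, truncPow, Set.indicator_of_mem]
            exact abs_le.1 (hxb x hx j)
          have h5 : ∀ j, 1 ≤ 4 * max |inner ℝ (b j) x| τ ^ (-β) := by
            intro j
            have hm : 0 < max |inner ℝ (b j) x| τ := hτ.trans_le (le_max_right _ _)
            have h6 : max |inner ℝ (b j) x| τ ^ β ≤ 4 := by
              calc _ ≤ (4 : ℝ) ^ β := Real.rpow_le_rpow hm.le
                    (max_le (hxb x hx j) (by linarith)) hβ.le
                _ ≤ 4 ^ (1 : ℝ) := Real.rpow_le_rpow_of_exponent_le (by norm_num) hβ1.le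
                _ = 4 := by norm_num
            rw [Real.rpow_neg hm.le, ← div_eq_mul_inv, one_le_div (by positivity)]
            exact h6
          calc ∏ j ∈ S, max |inner ℝ (b j) x| τ ^ (-β)
              ≤ ∏ j ∈ S, 4 * max |inner ℝ (b j) x| τ ^ (-β) := by
                refine Finset.prod_le_prod (fun _ _ => by positivity) fun j _ => ?_
                have : 0 ≤ max |inner ℝ (b j) x| τ ^ (-β) := by positivity
                linarith
            _ ≤ ∏ j, 4 * max |inner ℝ (b j) x| τ ^ (-β) :=
by
                rw [← Finset.prod_mul_prod_compl S]
                exact le_mul_of_one_le_right (Finset.prod_nonneg fun _ _ => by positivity)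
                  (Finset.prod_induction _ (fun y => 1 ≤ y) (fun _ _ => one_le_mul_of_one_le_of_one_le)
                    le_rfl fun j _ => h5 j)
            _ = _ := Finset.prod_congr rfl fun j _ => (h4 j).symm
    _ ≤ ∫ x, F (WithLp.ofLp (b.repr x)) :=
        setIntegral_le_integral hGint (Filter.Eventually.of_forall fun x => hF0 _)
    _ = ∫ y, F y := hmp.integral_comp hemb F
    _ = ∏ j : Fin n, ∫ y, truncPow β τ y := integral_fintype_prod_volume_eq_prod _
    _ ≤ ∏ j : Fin n, (8 * ∫ x in Set.Ioc (0 : ℝ) 4, x ^ (-β)) := by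
        refine Finset.prod_le_prod (fun _ _ => integral_nonneg (truncPow_nonneg hτ)) fun _ _ => ?_
        exact integral_truncPow_le hβ hβ1 hτ
    _ = _ := by simp

lemma exists_adapted_basis (V : Submodule ℝ 𝔼) :
    ∃ (b : OrthonormalBasis (Fin n) ℝ 𝔼) (S : Finset (Fin n)),
      S.card = n - Module.finrank ℝ V ∧ ∀ j ∈ S, b j ∈ Vᗮ := by
  have hdim : Module.finrank ℝ V + Module.finrank ℝ Vᗮ = n := by
    rw [Submodule.finrank_add_finrank_orthogonal, finrank_euclideanSpace_fin]
  set m := Module.finrank ℝ Vᗮ with hm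
  let u := stdOrthonormalBasis ℝ Vᗮ
  let v : Fin n → 𝔼 := fun j => if h : (j : ℕ) < m then (u ⟨j, h⟩ : 𝔼) else 0
  have hu : Orthonormal ℝ (fun j => (u j : 𝔼)) :=
    u.orthonormal.comp_linearIsometry (Vᗮ).subtypeₗᵢ
  let emb : {j : Fin n | (j : ℕ) < m} → Fin m := fun j => ⟨j.1, j.2⟩
  have hemb : Function.Injective emb := fun i j hij => by
    have : (i.1 : ℕ) = j.1 := Fin.mk.inj_iff.1 hij
    exact Subtype.ext (Fin.ext this)
  have hv : Orthonormal ℝ (Set.domRestrict {j : Fin n | (j : ℕ) < m} v) := by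
    have h2 : Set.domRestrict {j : Fin n | (j : ℕ) < m} v = (fun j => (u j : 𝔼)) ∘ emb := by
      funext j
      have hj : (j.1 : ℕ) < m := j.2
      simp [v, emb, hj]
    rw [h2]
    exact hu.comp _ hemb
  obtain ⟨b, hb⟩ := hv.exists_orthonormalBasis_extension_of_card_eq
    (by rw [finrank_euclideanSpace_fin, Fintype.card_fin])
  refine ⟨b, Finset.univ.filter fun j => (j : ℕ) < m, ?_, fun j hj => ?_⟩
  · rw [Fin.card_filter_val_lt]; omega
  · have hj' : (j : ℕ) < m := by simpa using hj
    rw [hb j hj']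
    simp only [v, hj', dif_pos]
    exact (u _).2

lemma setIntegral_max_proj_le {β : ℝ} (hβ : 0 < β) (hβ1 : β < 1) {τ : ℝ} (hτ : 0 < τ)
    (hτ1 : τ ≤ 1) {p : 𝔼} (hp : ‖p‖ ≤ 3) (V : Submodule ℝ 𝔼) (k : ℕ)
    (hk : β * (n - Module.finrank ℝ V : ℕ) ≤ k) :
    ∫ x in Metric.closedBall p 1, (max ‖Vᗮ.starProjection x‖ τ)⁻¹ ^ k
      ≤ τ ^ (β * (n - Module.finrank ℝ V : ℕ) - k) *
        (8 * ∫ x in Set.Ioc (0 : ℝ) 4, x ^ (-β)) ^ n := by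
  obtain ⟨b, S, hS, hbS⟩ := exists_adapted_basis V
  rw [← hS] at hk ⊢
  refine le_trans ?_ (mul_le_mul_of_nonneg_left
    (setIntegral_prod_max_rpow_le hβ hβ1 hτ hτ1 hp b S) (by positivity))
  rw [← integral_const_mul]
  have hcont : Continuous fun x : 𝔼 => ‖Vᗮ.starProjection x‖ :=
    (Vᗮ.starProjection).continuous.norm
  refine setIntegral_mono_on ?_ ?_ Metric.isClosed_closedBall.measurableSet fun x _ => ?_
  · refine ContinuousOn.integrableOn_compact (isCompact_closedBall _ _)
      (Continuous.continuousOn ?_)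
    exact ((hcont.max continuous_const).inv₀
      fun x => (hτ.trans_le (le_max_right _ _)).ne').pow k
  · refine ContinuousOn.integrableOn_compact (isCompact_closedBall _ _)
      (Continuous.continuousOn ?_)
    exact continuous_const.mul (continuous_finsetProd _ fun j _ =>
      continuous_max_rpow (continuous_const.inner continuous_id).abs hτ _)
  · set D := max ‖Vᗮ.starProjection x‖ τ with hD
    have hD0 : 0 < D := hτ.trans_le (le_max_right _ _)
    have h1 : D⁻¹ ^ k = D ^ (β * S.card - k) * ∏ j ∈ S, D ^ (-β) := by
      rw [Finset.prod_const, ← Real.rpow_natCast (D ^ (-β)), ← Real.rpow_mul hD0.le,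
        ← Real.rpow_add hD0, inv_pow, ← Real.rpow_natCast D, ← Real.rpow_neg hD0.le]
      congr 1
      ring
    rw [h1]
    refine mul_le_mul (Real.rpow_le_rpow_of_nonpos hτ (le_max_right _ _) (by linarith))
      (Finset.prod_le_prod (fun _ _ => by positivity) fun j hj => ?_)
      (Finset.prod_nonneg fun _ _ => by positivity) (by positivity)
    refine Real.rpow_le_rpow_of_nonpos (hτ.trans_le (le_max_right _ _))
      (max_le_max_right _ ?_) (by linarith)
    have h2 : inner ℝ (b j) x = inner ℝ (b j) (Vᗮ.starProjection x) := by
      rw [← Submodule.inner_starProjection_left_eq_right,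
        Submodule.starProjection_eq_self_iff.2 (hbS j hj)]
    rw [h2]
    have h3 := abs_real_inner_le_norm (b j) (Vᗮ.starProjection x)
    rwa [b.orthonormal.1 j, one_mul] at h3

lemma exists_net_weights {p : 𝔼} {τ : ℝ} (hτ : 0 < τ) :
    ∃ (N : ℕ) (ξ : ℕ → 𝔼) (w : ℕ → ℝ), (∀ j, ‖ξ j - p‖ ≤ 1) ∧ (∀ j, 0 ≤ w j) ∧
      ∑ j ∈ Finset.range N, w j = 1 ∧
      ∀ (V : Submodule ℝ 𝔼) (k : ℕ),
        ∑ j ∈ Finset.range N, w j * (max ‖Vᗮ.starProjection (ξ j)‖ τ)⁻¹ ^ k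
          ≤ 2 ^ k * ((volume (Metric.closedBall p 1)).toReal⁻¹ *
            ∫ x in Metric.closedBall p 1, (max ‖Vᗮ.starProjection x‖ τ)⁻¹ ^ k) := by
  set B := Metric.closedBall p 1 with hB
  have hvol : 0 < (volume B).toReal :=
    ENNReal.toReal_pos (Metric.measure_closedBall_pos _ _ one_pos).ne'
      measure_closedBall_lt_top.ne
  obtain ⟨T, hTB, hTfin, hTcov⟩ := (isCompact_closedBall p 1).finite_cover_balls hτ
  have hTne : T.Nonempty := by
    have := hTcov (Metric.mem_closedBall_self zero_le_one)
    simp only [Set.mem_iUnion] at this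
    obtain ⟨x, hx, -⟩ := this
    exact ⟨x, hx⟩
  obtain ⟨e, he⟩ := hTfin.countable.exists_eq_range hTne
  obtain ⟨M, hM⟩ : ∃ M, ∀ x ∈ T, ∃ k ≤ M, e k = x := by
    have : ∀ x ∈ T, ∃ k, e k = x := fun x hx => by rw [he] at hx; exact hx
    choose! g hg using this
    obtain ⟨M, hM⟩ := (hTfin.image g).bddAbove
    exact ⟨M, fun x hx => ⟨g x, hM ⟨x, hx, rfl⟩, hg x hx⟩⟩
  let q := SimpleFunc.nearestPtInd e M
  let A : ℕ → Set 𝔼 := fun j => B ∩ q ⁻¹' {j}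
  have hAm : ∀ j, MeasurableSet (A j) := fun j =>
    Metric.isClosed_closedBall.measurableSet.inter (q.measurableSet_preimage _)
  have hAB : ∀ j, A j ⊆ B := fun j => Set.inter_subset_left
  have hAd : ((Finset.range (M + 1) : Finset ℕ) : Set ℕ).Pairwise (Function.onFun Disjoint A) := by
    intro i _ j _ hij
    refine Set.disjoint_left.2 fun x hx hx' => hij ?_
    exact (hx.2 : q x = i).symm.trans hx'.2
  have hAU : ⋃ j ∈ Finset.range (M + 1), A j = B := by
    refine Set.Subset.antisymm (Set.iUnion₂_subset fun j _ => hAB j) fun x hx => ?_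
    simp only [Set.mem_iUnion]
    exact ⟨q x, Finset.mem_range_succ_iff.2 (SimpleFunc.nearestPtInd_le e M x), hx, rfl⟩
  have hnear : ∀ j, ∀ x ∈ A j, ‖e j - x‖ ≤ τ := by
    rintro j x ⟨hxB, hxj⟩
    have h1 := hTcov hxB
    simp only [Set.mem_iUnion] at h1
    obtain ⟨y, hyT, hy⟩ := h1
    obtain ⟨m, hm, rfl⟩ := hM y hyT
    have h2 := SimpleFunc.edist_nearestPt_le e x hm
    have h3 : SimpleFunc.nearestPt e M x = e j := by
      rw [SimpleFunc.nearestPt, SimpleFunc.map_apply]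
      exact congrArg e hxj
    rw [h3, edist_dist, edist_dist, ENNReal.ofReal_le_ofReal_iff dist_nonneg] at h2
    rw [← dist_eq_norm]
    rw [Metric.mem_ball, dist_comm] at hy
    exact h2.trans hy.le
  refine ⟨M + 1, e, fun j => (volume B).toReal⁻¹ * (volume (A j)).toReal, fun j => ?_,
    fun j => by positivity, ?_, fun V k => ?_⟩
  · have : e j ∈ B := hTB (he ▸ Set.mem_range_self j)
    rwa [hB, Metric.mem_closedBall, dist_eq_norm] at this
  · rw [← Finset.mul_sum]
    have h1 := measureReal_biUnion_finset (μ := volume) hAd (fun j _ => hAm j)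
      (fun j _ => (measure_mono (hAB j)).trans_lt measure_closedBall_lt_top |>.ne)
    rw [hAU] at h1
    rw [inv_mul_eq_one₀ hvol.ne']
    exact h1
  · have hcont : Continuous fun x : 𝔼 => (max ‖Vᗮ.starProjection x‖ τ)⁻¹ ^ k :=
      (((Vᗮ.starProjection).continuous.norm.max continuous_const).inv₀
        fun x => (hτ.trans_le (le_max_right _ _)).ne').pow k
    have hInt : IntegrableOn (fun x : 𝔼 => (max ‖Vᗮ.starProjection x‖ τ)⁻¹ ^ k) B :=
      hcont.continuousOn.integrableOn_compact (isCompact_closedBall _ _)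
    have h1 := integral_biUnion_finset (Finset.range (M + 1)) (fun j _ => hAm j) hAd
      (fun j _ => hInt.mono_set (hAB j))
    rw [hAU] at h1
    rw [h1, Finset.mul_sum, Finset.mul_sum]
    refine Finset.sum_le_sum fun j _ => ?_
    have h2 : (volume (A j)).toReal * (max ‖Vᗮ.starProjection (e j)‖ τ)⁻¹ ^ k
        ≤ 2 ^ k * ∫ x in A j, (max ‖Vᗮ.starProjection x‖ τ)⁻¹ ^ k := by
      rw [← integral_const_mul]
      have h3 : (volume (A j)).toReal * (max ‖Vᗮ.starProjection (e j)‖ τ)⁻¹ ^ k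
          = ∫ x in A j, (max ‖Vᗮ.starProjection (e j)‖ τ)⁻¹ ^ k := by
        rw [setIntegral_const, smul_eq_mul]; rfl
      rw [h3]
      refine setIntegral_mono_on ?_ ((hInt.mono_set (hAB j)).const_mul _) (hAm j) fun x hx => ?_
      · exact integrableOn_const
          ((measure_mono (hAB j)).trans_lt measure_closedBall_lt_top).ne
      · rw [← mul_pow]
        have hD0 : 0 < max ‖Vᗮ.starProjection x‖ τ := hτ.trans_le (le_max_right _ _)
        have hD1 : 0 < max ‖Vᗮ.starProjection (e j)‖ τ := hτ.trans_le (le_max_right _ _)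
        refine pow_le_pow_left₀ (by positivity) ?_ _
        rw [← div_eq_mul_inv, inv_eq_one_div, div_le_div_iff₀ hD1 hD0, one_mul]
        have h4 : ‖Vᗮ.starProjection x‖ ≤ ‖Vᗮ.starProjection (e j)‖ + τ := by
          have h5 := Submodule.norm_starProjection_apply_le Vᗮ (e j - x)
          rw [map_sub] at h5
          have h6 := norm_sub_norm_le (Vᗮ.starProjection x) (Vᗮ.starProjection (e j))
          rw [norm_sub_rev] at h6
          linarith [hnear j x hx]
        have h7 := le_max_left ‖Vᗮ.starProjection (e j)‖ τ
        have h8 := le_max_right ‖Vᗮ.starProjection (e j)‖ τ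
        exact max_le (by linarith) (by linarith)
    calc _ = (volume B).toReal⁻¹ *
          ((volume (A j)).toReal * (max ‖Vᗮ.starProjection (e j)‖ τ)⁻¹ ^ k) := by ring
      _ ≤ (volume B).toReal⁻¹ *
          (2 ^ k * ∫ x in A j, (max ‖Vᗮ.starProjection x‖ τ)⁻¹ ^ k) := by gcongr
      _ = _ := by ring

end NegativePowers

section Lyapunov

variable {n : ℕ}

local notation "𝔼" => EuclideanSpace ℝ (Fin n)

lemma contraction_exponent_le {k i : ℕ} (hn : 0 < n) (hk : 0 < k) (hi : i < n) {t : ℝ}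
    (ht : 1 ≤ t) :
    t⁻¹ ^ (i * k) * (t⁻¹ ^ n) ^ (((k : ℝ) * (n + 1) / n ^ 2) * (n - i : ℕ) - k)
      ≤ t ^ (-(1 / n : ℝ)) := by
  have ht0 : 0 < t := by linarith
  have hn0 : (0 : ℝ) < n := by exact_mod_cast hn
  rw [inv_pow, inv_pow, ← Real.rpow_natCast t, ← Real.rpow_natCast t, ← Real.rpow_neg ht0.le,
    ← Real.rpow_neg ht0.le, ← Real.rpow_mul ht0.le, ← Real.rpow_add ht0]
  refine Real.rpow_le_rpow_of_exponent_le ht ?_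
  rw [Nat.cast_sub hi.le]
  push_cast
  have h1 : (1 : ℝ) ≤ n - i := by
    have : (i : ℝ) + 1 ≤ n := by exact_mod_cast hi
    linarith
  have h2 : (1 : ℝ) ≤ k := by exact_mod_cast hk
  have h3 : -((i : ℝ) * k) + -n * ((k : ℝ) * (n + 1) / n ^ 2 * (n - i) - k)
      = -((n - i) * k / n) := by
    field_simp
    ring
  rw [h3, neg_le_neg_iff]
  gcongr
  nlinarith

set_option maxHeartbeats 1000000 in
/-- On average over finitely many contractions, each `latPhi i` either decreases or is
controlled by its neighbours. -/
lemma exists_average_contraction {k : ℕ} (hk : 0 < k) (hkn : k < n) {e : 𝔼} (he : ‖e‖ = 1) :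
    ∃ (t τ : ℝ) (N : ℕ) (ξ : ℕ → 𝔼) (w : ℕ → ℝ) (D : ℝ), 0 < t ∧ 0 < τ ∧ τ ≤ 1 ∧
      t ^ n * τ = 1 ∧ (∀ j, 1 ≤ inner ℝ e (ξ j) ∧ ‖ξ j‖ ≤ 4) ∧ (∀ j, 0 ≤ w j) ∧
      ∑ j ∈ Finset.range N, w j = 1 ∧ 0 ≤ D ∧
      ∀ L : AddSubgroup 𝔼, LocFin L → (∃ R, n ≤ latRank L R) → ∀ i, 1 ≤ i → i < n →
        (∑ j ∈ Finset.range N, w j * latPhi i (contrLat t τ e (ξ j) L) ^ k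
            ≤ 1 / 4 * latPhi i L ^ k) ∨
        (∑ j ∈ Finset.range N, w j * latPhi i (contrLat t τ e (ξ j) L) ^ k) ^ 2
            ≤ D * (latPhi (i - 1) L ^ k * latPhi (i + 1) L ^ k) := by
  have hn : 0 < n := hk.trans hkn
  have hn0 : (0 : ℝ) < n := by exact_mod_cast hn
  have hk0 : (0 : ℝ) < k := by exact_mod_cast hk
  set p : 𝔼 := (3 : ℝ) • e with hp
  have hpn : ‖p‖ ≤ 3 := by rw [hp, norm_smul, he]; norm_num
  obtain ⟨β, hβdef⟩ : ∃ β : ℝ, β = (k : ℝ) * (n + 1) / n ^ 2 := ⟨_, rfl⟩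
  have hβ : 0 < β := by rw [hβdef]; positivity
  have hkn' : (k : ℝ) + 1 ≤ n := by exact_mod_cast hkn
  have hβ1 : β < 1 := by
    rw [hβdef, div_lt_one (by positivity)]
    nlinarith
  obtain ⟨I, hI⟩ : ∃ I : ℝ, I = 8 * ∫ x in Set.Ioc (0 : ℝ) 4, x ^ (-β) := ⟨_, rfl⟩
  have hI0 : 0 ≤ I := hI ▸ mul_nonneg (by norm_num)
    (setIntegral_nonneg measurableSet_Ioc fun x hx => by have := hx.1; positivity)
  obtain ⟨vB, hvB⟩ : ∃ vB : ℝ, vB = (volume (Metric.closedBall p 1)).toReal⁻¹ := ⟨_, rfl⟩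
  have hvB0 : 0 ≤ vB := by rw [hvB]; positivity
  have hlc := one_le_latConst n
  obtain ⟨κ, hκ⟩ : ∃ κ : ℝ, κ = (20 * 24 ^ n * latConst n) ^ k := ⟨_, rfl⟩
  have hκ0 : 0 ≤ κ := by rw [hκ]; positivity
  obtain ⟨Q, hQ⟩ : ∃ Q : ℝ, Q = κ * (2 ^ k * (vB * I ^ n)) := ⟨_, rfl⟩
  have hQ0 : 0 ≤ Q := by rw [hQ]; positivity
  obtain ⟨T, hT⟩ : ∃ T : ℝ, T = 4 * Q + 2 := ⟨_, rfl⟩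
  have hT2 : 2 ≤ T := by linarith
  obtain ⟨t, htdef⟩ : ∃ t : ℝ, t = T ^ n := ⟨_, rfl⟩
  have ht1 : 2 ≤ t := htdef ▸ hT2.trans (le_self_pow₀ (by linarith) hn.ne')
  have ht0 : 0 < t := by linarith
  obtain ⟨τ, hτdef⟩ : ∃ τ : ℝ, τ = t⁻¹ ^ n := ⟨_, rfl⟩
  have hτ : 0 < τ := by rw [hτdef]; positivity
  have htinv : t⁻¹ ≤ 1 / 2 := by rw [inv_le_comm₀ ht0 (by norm_num)]; linarith
  have hτ2 : τ ≤ 1 / 2 := hτdef ▸ (pow_le_of_le_one (by positivity) (by linarith) hn.ne').trans htinv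
  have hτ1 : τ ≤ 1 := by linarith
  have htT : t ^ (-(1 / n : ℝ)) = T⁻¹ := by
    rw [htdef, ← Real.rpow_natCast T, ← Real.rpow_mul (by linarith)]
    rw [show (n : ℝ) * (-(1 / n)) = -1 by field_simp, Real.rpow_neg_one]
  have hτt : τ * t ≤ 1 := by
    obtain ⟨m, rfl⟩ : ∃ m, n = m + 1 := ⟨n - 1, by omega⟩
    rw [hτdef, pow_succ, mul_assoc, inv_mul_cancel₀ ht0.ne', mul_one]
    exact pow_le_one₀ (by positivity) (by linarith)
  obtain ⟨N, ξ, w, hξ, hw, hw1, hnet⟩ := exists_net_weights (p := p) hτ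
  rw [← hvB] at hnet
  have hξ4 : ∀ j, ‖ξ j‖ ≤ 4 := fun j => by
    have h2 : ‖ξ j‖ ≤ ‖ξ j - p‖ + ‖p‖ := by simpa using norm_add_le (ξ j - p) p
    linarith [hξ j]
  have hξe : ∀ j, 1 ≤ inner ℝ e (ξ j) := fun j => by
    have h1 := abs_real_inner_le_norm e (ξ j - p)
    rw [he, one_mul, inner_sub_right, hp, inner_smul_right, real_inner_self_eq_norm_sq, he] at h1
    have h2 := (abs_le.1 (h1.trans (hξ j))).1
    linarith
  obtain ⟨s, hs⟩ : ∃ s : ℝ, s = 2 * (5 / (t * τ)) := ⟨_, rfl⟩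
  have hs1 : 1 ≤ s := by
    have : 1 ≤ 5 / (t * τ) := by rw [one_le_div (by positivity)]; linarith
    rw [hs]; linarith
  obtain ⟨K, hK⟩ : ∃ K : ℝ, K = 1 / (2 * τ) := ⟨_, rfl⟩
  have hK1 : 1 ≤ K := by rw [hK, one_le_div (by positivity)]; linarith
  refine ⟨t, τ, N, ξ, w, ((s ^ n) ^ k) ^ 2 * ((8 ^ n * latConst n) ^ 2 * K ^ (n + 1)) ^ k, ht0, hτ,
    hτ1, ?_, fun j => ⟨hξe j, hξ4 j⟩, hw, hw1, by positivity, fun L hL hspan i hi hin => ?_⟩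
  · rw [hτdef, ← mul_pow, mul_inv_cancel₀ ht0.ne', one_pow]
  obtain ⟨ρ, hρ, hr1, hr2⟩ := exists_scale hL hi (hspan.imp fun _ h => hin.le.trans h)
  have hfr : Module.finrank ℝ 𝔼 ≤ n := finrank_euclideanSpace_fin.le
  have hKρ : K * ρ = ρ / (2 * τ) := by rw [hK]; ring
  rcases Nat.lt_or_ge i (latRank L (K * ρ)) with hgap | hgap
  · right
    have h1 := latPhi_sq_le hL hfr hi hin hρ hK1 hr1 hr2 hgap
    have h2 : ∑ j ∈ Finset.range N, w j * latPhi i (contrLat t τ e (ξ j) L) ^ k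
        ≤ (s ^ n) ^ k * latPhi i L ^ k := by
      calc _ ≤ ∑ j ∈ Finset.range N, w j * ((s ^ n) ^ k * latPhi i L ^ k) := by
            refine Finset.sum_le_sum fun j _ => mul_le_mul_of_nonneg_left ?_ (hw j)
            rw [← mul_pow]
            refine pow_le_pow_left₀ (latPhi_nonneg _ _) ?_ _
            refine (latPhi_contrLat_le ht0 hτ hτ1 he (hξe j) (hξ4 j) hL i).trans ?_
            rw [← hs]
            exact mul_le_mul_of_nonneg_right (pow_le_pow_right₀ hs1 hin.le) (latPhi_nonneg _ _)
        _ = _ := by rw [← Finset.sum_mul, hw1, one_mul]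
    have h3 : 0 ≤ ∑ j ∈ Finset.range N, w j * latPhi i (contrLat t τ e (ξ j) L) ^ k :=
      Finset.sum_nonneg fun j _ => mul_nonneg (hw j) (pow_nonneg (latPhi_nonneg _ _) _)
    calc _ ≤ ((s ^ n) ^ k * latPhi i L ^ k) ^ 2 := pow_le_pow_left₀ h3 h2 2
      _ = ((s ^ n) ^ k) ^ 2 * (latPhi i L ^ 2) ^ k := by ring
      _ ≤ ((s ^ n) ^ k) ^ 2 * ((8 ^ n * latConst n) ^ 2 * K ^ (n + 1) *
            (latPhi (i - 1) L * latPhi (i + 1) L)) ^ k := by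
          have h4 : 0 ≤ latPhi (i - 1) L * latPhi (i + 1) L :=
            mul_nonneg (latPhi_nonneg _ _) (latPhi_nonneg _ _)
          refine mul_le_mul_of_nonneg_left (pow_le_pow_left₀ (by positivity) (h1.trans ?_) _)
            (by positivity)
          refine mul_le_mul_of_nonneg_right ?_ h4
          refine mul_le_mul (pow_le_pow_left₀ (by positivity) ?_ _)
            (pow_le_pow_right₀ hK1 (by omega)) (by positivity) (by positivity)
          exact mul_le_mul_of_nonneg_right (pow_le_pow_right₀ (by norm_num) hin.le) (by linarith)
      _ = _ := by
          rw [← mul_pow (latPhi (i - 1) L), mul_pow _ (latPhi (i - 1) L * latPhi (i + 1) L), mul_assoc]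
  · left
    set V := Submodule.span ℝ (latBall L (ρ / (2 * τ))) with hV
    have hVi : Module.finrank ℝ V = i := by
      rw [hKρ] at hgap
      refine le_antisymm hgap (hr1.trans (latRank_mono L ?_))
      rw [← hKρ]; nlinarith
    have h1 : ∀ j, latPhi i (contrLat t τ e (ξ j) L) ^ k
        ≤ (κ * t⁻¹ ^ (i * k) * latPhi i L ^ k) * (max ‖Vᗮ.starProjection (ξ j)‖ τ)⁻¹ ^ k := by
      intro j
      have h2 := latPhi_contrLat_le_of_gap ht0 hτ hτ1 he (hξe j) (hξ4 j) hL hfr hin.le hρ hr1 hr2 hV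
      have hm : 0 < max ‖Vᗮ.starProjection (ξ j)‖ τ := hτ.trans_le (le_max_right _ _)
      calc _ ≤ (20 * 24 ^ n * latConst n *
            (t⁻¹ ^ i * (max ‖Vᗮ.starProjection (ξ j)‖ τ)⁻¹) * latPhi i L) ^ k := by
            refine pow_le_pow_left₀ (latPhi_nonneg _ _) (h2.trans ?_) _
            refine mul_le_mul_of_nonneg_right ?_ (latPhi_nonneg _ _)
            refine mul_le_mul_of_nonneg_right ?_ (by positivity)
            refine mul_le_mul_of_nonneg_right ?_ (by linarith)
            exact mul_le_mul_of_nonneg_left (pow_le_pow_right₀ (by norm_num) hin.le) (by norm_num)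
        _ = _ := by
            rw [hκ, mul_pow, mul_pow (20 * 24 ^ n * latConst n), mul_pow (t⁻¹ ^ i), ← pow_mul]
            ring
    have hβk : β * (n - Module.finrank ℝ V : ℕ) ≤ k := by
      rw [hVi, Nat.cast_sub hin.le, hβdef, div_mul_eq_mul_div, div_le_iff₀ (by positivity), mul_assoc]
      refine mul_le_mul_of_nonneg_left ?_ hk0.le
      have : (1 : ℝ) ≤ i := by exact_mod_cast hi
      nlinarith
    have h3 := setIntegral_max_proj_le hβ hβ1 hτ hτ1 hpn V k hβk
    rw [← hI] at h3
    have hF0 : 0 ≤ latPhi i L ^ k := pow_nonneg (latPhi_nonneg _ _) _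
    calc _ ≤ ∑ j ∈ Finset.range N, (κ * t⁻¹ ^ (i * k) * latPhi i L ^ k) *
          (w j * (max ‖Vᗮ.starProjection (ξ j)‖ τ)⁻¹ ^ k) := by
          refine Finset.sum_le_sum fun j _ => ?_
          refine (mul_le_mul_of_nonneg_left (h1 j) (hw j)).trans_eq ?_
          ring
      _ = (κ * t⁻¹ ^ (i * k) * latPhi i L ^ k) *
          ∑ j ∈ Finset.range N, w j * (max ‖Vᗮ.starProjection (ξ j)‖ τ)⁻¹ ^ k := by
          rw [Finset.mul_sum]
      _ ≤ (κ * t⁻¹ ^ (i * k) * latPhi i L ^ k) * (2 ^ k * (vB *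
          (τ ^ (β * (n - Module.finrank ℝ V : ℕ) - k) * I ^ n))) := by
          refine mul_le_mul_of_nonneg_left ((hnet V k).trans ?_) (by positivity)
          exact mul_le_mul_of_nonneg_left (mul_le_mul_of_nonneg_left h3 hvB0) (by positivity)
      _ = Q * (t⁻¹ ^ (i * k) * τ ^ (β * (n - i : ℕ) - k)) * latPhi i L ^ k := by
          rw [hVi, hQ]; ring
      _ ≤ Q * T⁻¹ * latPhi i L ^ k := by
          refine mul_le_mul_of_nonneg_right (mul_le_mul_of_nonneg_left ?_ hQ0) hF0
          rw [← htT]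
          rw [hτdef, hβdef]
          exact contraction_exponent_le hn hk hin (one_le_two.trans ht1)
      _ ≤ _ := by
          refine mul_le_mul_of_nonneg_right ?_ hF0
          rw [← div_eq_mul_inv, div_le_iff₀ (show 0 < T by linarith)]
          linarith

/-- The Lyapunov function. -/
noncomputable def latLyap (n k : ℕ) (ε : ℝ) (L : AddSubgroup 𝔼) : ℝ :=
  ∑ i ∈ Finset.Ico 1 n, ε ^ (i * (n - i)) * latPhi i L ^ k

lemma exists_lyapunov {k : ℕ} (hk : 0 < k) (hkn : k < n) {e : 𝔼} (he : ‖e‖ = 1) {P : ℝ} :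
    ∃ (t τ : ℝ) (N : ℕ) (ξ : ℕ → 𝔼) (w : ℕ → ℝ) (ε b : ℝ), 0 < t ∧ 0 < τ ∧ τ ≤ 1 ∧
      t ^ n * τ = 1 ∧ (∀ j, 1 ≤ inner ℝ e (ξ j) ∧ ‖ξ j‖ ≤ 4) ∧ (∀ j, 0 ≤ w j) ∧
      ∑ j ∈ Finset.range N, w j = 1 ∧ 0 < ε ∧
      ∀ L : AddSubgroup 𝔼, LocFin L → (∃ R, n ≤ latRank L R) → latPhi n L ≤ P →
        ∑ j ∈ Finset.range N, w j * latLyap n k ε (contrLat t τ e (ξ j) L)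
          ≤ 1 / 2 * latLyap n k ε L + b := by
  obtain ⟨t, τ, N, ξ, w, D, ht, hτ, hτ1, htτ, hξ, hw, hw1, hD, H⟩ :=
    exists_average_contraction hk hkn he
  set ε : ℝ := 1 / (4 * (D + 1)) with hε
  have hε0 : 0 < ε := by positivity
  have hεD : (D + 1) * ε = 1 / 4 := by rw [hε]; field_simp
  refine ⟨t, τ, N, ξ, w, ε, 1 / 4 * (1 + P ^ k), ht, hτ, hτ1, htτ, hξ, hw, hw1, hε0,
    fun L hL hspan hP => ?_⟩
  set a : ℕ → ℝ := fun i => ε ^ (i * (n - i)) * latPhi i L ^ k with ha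
  have ha0 : ∀ i, 0 ≤ a i := fun i => mul_nonneg (by positivity) (pow_nonneg (latPhi_nonneg _ _) _)
  have hstep : ∀ i ∈ Finset.Ico 1 n,
      ε ^ (i * (n - i)) * ∑ j ∈ Finset.range N, w j * latPhi i (contrLat t τ e (ξ j) L) ^ k
        ≤ 1 / 4 * a i + 1 / 8 * (a (i - 1) + a (i + 1)) := by
    intro i hi
    rw [Finset.mem_Ico] at hi
    set A := ∑ j ∈ Finset.range N, w j * latPhi i (contrLat t τ e (ξ j) L) ^ k with hA
    rcases H L hL hspan i hi.1 hi.2 with h | h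
    · have h1 : ε ^ (i * (n - i)) * A ≤ 1 / 4 * a i := by
        refine (mul_le_mul_of_nonneg_left h (by positivity)).trans_eq ?_
        simp only [ha]; ring
      linarith [ha0 (i - 1), ha0 (i + 1)]
    · have h1 : (ε ^ (i * (n - i)) * A) ^ 2 ≤ (1 / 8 * (a (i - 1) + a (i + 1))) ^ 2 := by
        have hexp : (ε ^ (i * (n - i))) ^ 2
            = ε ^ 2 * (ε ^ ((i - 1) * (n - (i - 1))) * ε ^ ((i + 1) * (n - (i + 1)))) := by
          rw [← pow_mul, ← pow_add, ← pow_add]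
          congr 1
          obtain ⟨i', rfl⟩ : ∃ i', i = i' + 1 := ⟨i - 1, by omega⟩
          obtain ⟨m, rfl⟩ : ∃ m, n = i' + 1 + 1 + m := ⟨n - (i' + 2), by omega⟩
          have e1 : i' + 1 + 1 + m - (i' + 1) = m + 1 := by omega
          have e2 : i' + 1 + 1 + m - (i' + 1 - 1) = m + 2 := by omega
          have e3 : i' + 1 + 1 + m - (i' + 1 + 1) = m := by omega
          rw [e1, e2, e3, Nat.add_sub_cancel]
          ring
        calc (ε ^ (i * (n - i)) * A) ^ 2 = (ε ^ (i * (n - i))) ^ 2 * A ^ 2 := mul_pow _ _ _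
          _ ≤ (ε ^ (i * (n - i))) ^ 2 * (D * (latPhi (i - 1) L ^ k * latPhi (i + 1) L ^ k)) := by
              gcongr
          _ = D * ε ^ 2 * (a (i - 1) * a (i + 1)) := by rw [hexp]; simp only [ha]; ring
          _ ≤ ((D + 1) * ε) ^ 2 * (a (i - 1) * a (i + 1)) := by
              refine mul_le_mul_of_nonneg_right ?_ (mul_nonneg (ha0 _) (ha0 _))
              rw [mul_pow]
              refine mul_le_mul_of_nonneg_right ?_ (by positivity)
              nlinarith
          _ ≤ _ := by
              rw [hεD]
              nlinarith [sq_nonneg (a (i - 1) - a (i + 1))]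
      have h2 := abs_le_of_sq_le_sq h1 (by linarith [ha0 (i - 1), ha0 (i + 1)])
      linarith [(abs_le.1 h2).2, ha0 i]
  have hsplit : ∀ g : ℕ → ℝ, (∀ i, 0 ≤ g i) →
      ∑ i ∈ Finset.Ico 1 n, (g (i - 1) + g (i + 1)) ≤ 2 * (g 0 + g n + ∑ i ∈ Finset.Ico 1 n, g i) := by
    intro g hg
    have hn1 : 1 ≤ n := by omega
    rw [Finset.sum_add_distrib]
    have e1 : ∑ i ∈ Finset.Ico 1 n, g (i - 1) ≤ g 0 + ∑ i ∈ Finset.Ico 1 n, g i := by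
      have : ∑ i ∈ Finset.Ico 1 n, g (i - 1) = ∑ i ∈ Finset.range (n - 1), g i := by
        rw [Finset.sum_Ico_eq_sum_range]
        exact Finset.sum_congr rfl fun i _ => by rw [Nat.add_sub_cancel_left]
      rw [this, ← Finset.sum_range_eq_add_Ico g (by omega)]
      exact Finset.sum_le_sum_of_subset_of_nonneg (Finset.range_mono (by omega)) fun i _ _ => hg i
    have e2 : ∑ i ∈ Finset.Ico 1 n, g (i + 1) ≤ g n + ∑ i ∈ Finset.Ico 1 n, g i := by
      rw [Finset.sum_Ico_add' g 1 n 1, Finset.sum_Ico_succ_top (by omega), add_comm]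
      gcongr
      · intro i _ _; exact hg i
      · omega
    linarith [hg 0, hg n]
  have h0 : a 0 ≤ 1 := by
    simp only [ha, zero_mul, pow_zero, one_mul]
    exact pow_le_one₀ (latPhi_nonneg _ _) (latPhi_zero_le hL)
  have hn' : a n ≤ P ^ k := by
    simp only [ha, Nat.sub_self, mul_zero, pow_zero, one_mul]
    exact pow_le_pow_left₀ (latPhi_nonneg _ _) hP _
  have hsum := hsplit a ha0
  calc _ = ∑ i ∈ Finset.Ico 1 n, ε ^ (i * (n - i)) *
        ∑ j ∈ Finset.range N, w j * latPhi i (contrLat t τ e (ξ j) L) ^ k := by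
        simp only [latLyap, Finset.mul_sum]
        rw [Finset.sum_comm]
        exact Finset.sum_congr rfl fun i _ => Finset.sum_congr rfl fun j _ => by ring
    _ ≤ ∑ i ∈ Finset.Ico 1 n, (1 / 4 * a i + 1 / 8 * (a (i - 1) + a (i + 1))) :=
        Finset.sum_le_sum hstep
    _ = 1 / 4 * ∑ i ∈ Finset.Ico 1 n, a i
        + 1 / 8 * ∑ i ∈ Finset.Ico 1 n, (a (i - 1) + a (i + 1)) := by
        rw [Finset.sum_add_distrib, Finset.mul_sum, Finset.mul_sum]
    _ ≤ _ := by
        have : latLyap n k ε L = ∑ i ∈ Finset.Ico 1 n, a i := rfl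
        rw [this]
        linarith

end Lyapunov

section IntegerPoints

variable {ι : Type*} [Fintype ι]

/-- Counting the integer points of dilates of a Jordan measurable set. -/
lemma tendsto_ncard_intPoints {s : Set (ι → ℝ)} (hb : Bornology.IsBounded s)
    (hm : MeasurableSet s) (hf : volume (frontier s) = 0) :
    Filter.Tendsto (fun N : ℕ =>
      ({m : ι → ℤ | (fun i => (N : ℝ)⁻¹ * (m i : ℝ)) ∈ s}.ncard : ℝ) / (N : ℝ) ^ Fintype.card ι)
      Filter.atTop (nhds (volume.real s)) := by
  refine (tendsto_card_div_pow_atTop_volume s hb hm hf).congr' ?_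
  filter_upwards [Filter.eventually_gt_atTop 0] with N hN
  have hN0 : (N : ℝ)⁻¹ ≠ 0 := by positivity
  congr 2
  rw [Nat.card_coe_set_eq]
  have hinj : Function.Injective (fun (m : ι → ℤ) (i : ι) => (N : ℝ)⁻¹ * (m i : ℝ)) := by
    intro m m' h
    funext i
    have := congrFun h i
    exact_mod_cast mul_left_cancel₀ hN0 this
  rw [← Set.ncard_image_of_injective _ hinj]
  congr 1
  ext x
  simp only [Set.mem_inter_iff, Set.mem_image, Set.mem_ofPred_eq]
  constructor
  · rintro ⟨hx, hx2⟩
    obtain ⟨y, hy, rfl⟩ := hx2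
    have hy' := ((Pi.basisFun ℝ ι).mem_span_iff_repr_mem ℤ y).1 hy
    choose m hm using hy'
    have hm' : ∀ i, (m i : ℝ) = y i := fun i => by simpa using hm i
    have e : (fun i => (N : ℝ)⁻¹ * (m i : ℝ)) = (N : ℝ)⁻¹ • y := by
      funext i; rw [hm']; rfl
    exact ⟨m, by rw [e]; exact hx, e⟩
  · rintro ⟨m, hm, rfl⟩
    refine ⟨hm, ⟨fun i => (m i : ℝ), ?_, rfl⟩⟩
    refine ((Pi.basisFun ℝ ι).mem_span_iff_repr_mem ℤ _).2 fun i => ⟨m i, by simp⟩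

lemma finite_intPoints (R : ℝ) : {m : ι → ℤ | ∀ i, |(m i : ℝ)| ≤ R}.Finite := by
  refine ((isCompact_closedBall (0 : ι → ℤ) (max R 0)).finite_of_discrete).subset fun m hm => ?_
  rw [mem_closedBall_zero_iff, pi_norm_le_iff_of_nonneg (le_max_right _ _)]
  intro i
  rw [Int.norm_eq_abs]
  exact (hm i).trans (le_max_left _ _)

end IntegerPoints

section MatrixLattices

variable {n : ℕ}

local notation "𝔼" => EuclideanSpace ℝ (Fin n)

/-- Right multiplication of row vectors by a matrix, with values in Euclidean space. -/
noncomputable def rowMap (g : Matrix (Fin n) (Fin n) ℝ) : (Fin n → ℝ) →ₗ[ℝ] 𝔼 :=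
  (WithLp.linearEquiv 2 ℝ (Fin n → ℝ)).symm.toLinearMap ∘ₗ g.vecMulLinear

lemma rowMap_apply (g : Matrix (Fin n) (Fin n) ℝ) (c : Fin n → ℝ) :
    rowMap g c = WithLp.toLp 2 (c ᵥ* g) := rfl

/-- The inclusion of integer vectors into real vectors. -/
def intVec {ι : Type*} : (ι → ℤ) →+ (ι → ℝ) where
  toFun m i := (m i : ℝ)
  map_zero' := by ext; simp
  map_add' a b := by ext; simp

lemma intVec_apply {ι : Type*} (m : ι → ℤ) : intVec m = fun i => (m i : ℝ) := rfl

lemma intVec_injective {ι : Type*} : Function.Injective (intVec : (ι → ℤ) → ι → ℝ) := by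
  intro a b h
  funext i
  have := congrFun h i
  simpa [intVec_apply] using this

/-- The lattice spanned by the rows of a matrix. -/
noncomputable def matLat (g : Matrix (Fin n) (Fin n) ℝ) : AddSubgroup 𝔼 :=
  ((rowMap g).toAddMonoidHom.comp intVec).range

lemma mem_matLat {g : Matrix (Fin n) (Fin n) ℝ} {x : 𝔼} :
    x ∈ matLat g ↔ ∃ m : Fin n → ℤ, rowMap g (intVec m) = x := Iff.rfl

lemma SLR.val_mul_inv (g : SLR n) : g.1 * g⁻¹.1 = 1 := congrArg Subtype.val (mul_inv_cancel g)

lemma SLR.val_inv_mul (g : SLR n) : g⁻¹.1 * g.1 = 1 := congrArg Subtype.val (inv_mul_cancel g)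

lemma rowMap_injective (g : SLR n) : Function.Injective (rowMap g.1) := by
  intro c c' h
  rw [rowMap_apply, rowMap_apply] at h
  have h2 := congrArg (fun v => v ᵥ* g⁻¹.1) (WithLp.toLp_injective 2 h)
  simpa only [vecMul_vecMul, SLR.val_mul_inv, vecMul_one] using h2

lemma rowMap_surjective (g : SLR n) : Function.Surjective (rowMap g.1) := by
  intro x
  refine ⟨WithLp.ofLp x ᵥ* g⁻¹.1, ?_⟩
  rw [rowMap_apply, vecMul_vecMul, SLR.val_inv_mul, vecMul_one]

lemma exists_abs_le_norm_rowMap (g : SLR n) :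
    ∃ C, 0 ≤ C ∧ ∀ c i, |c i| ≤ C * ‖rowMap g.1 c‖ := by
  let T : 𝔼 →ₗ[ℝ] (Fin n → ℝ) := g⁻¹.1.vecMulLinear ∘ₗ
    (WithLp.linearEquiv 2 ℝ (Fin n → ℝ)).toLinearMap
  refine ⟨‖LinearMap.toContinuousLinearMap T‖, norm_nonneg _, fun c i => ?_⟩
  have h1 : LinearMap.toContinuousLinearMap T (rowMap g.1 c) = c := by
    change (c ᵥ* g.1) ᵥ* g⁻¹.1 = c
    rw [vecMul_vecMul, SLR.val_mul_inv, vecMul_one]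
  have h2 := (LinearMap.toContinuousLinearMap T).le_opNorm (rowMap g.1 c)
  rw [h1] at h2
  exact (norm_le_pi_norm c i).trans h2

lemma finite_rowMap_le (g : SLR n) (R : ℝ) :
    {m : Fin n → ℤ | ‖rowMap g.1 (intVec m)‖ ≤ R}.Finite := by
  obtain ⟨C, hC, h⟩ := exists_abs_le_norm_rowMap g
  refine (finite_intPoints (C * R)).subset fun m hm i => ?_
  exact (h (intVec m) i).trans (mul_le_mul_of_nonneg_left hm hC)

lemma latBall_matLat (g : Matrix (Fin n) (Fin n) ℝ) (R : ℝ) :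
    latBall (matLat g) R
      = (fun m => rowMap g (intVec m)) '' {m : Fin n → ℤ | ‖rowMap g (intVec m)‖ ≤ R} := by
  ext x
  constructor
  · rintro ⟨⟨m, rfl⟩, h⟩
    exact ⟨m, h, rfl⟩
  · rintro ⟨m, h, rfl⟩
    exact ⟨⟨m, rfl⟩, h⟩

lemma locFin_matLat (g : SLR n) : LocFin (matLat g.1) := fun R => by
  rw [latBall_matLat]
  exact (finite_rowMap_le g R).image _

lemma latCount_matLat (g : SLR n) (R : ℝ) :
    latCount (matLat g.1) R
      = {m : Fin n → ℤ | ‖rowMap g.1 (intVec m)‖ ≤ R}.ncard := by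
  rw [latCount, latBall_matLat]
  exact Set.ncard_image_of_injective _ ((rowMap_injective g).comp intVec_injective)

lemma exists_le_latRank_matLat (g : SLR n) : ∃ R, n ≤ latRank (matLat g.1) R := by
  set v : Fin n → 𝔼 := fun i => rowMap g.1 (intVec (Pi.single i 1)) with hv
  refine ⟨∑ i, ‖v i‖, ?_⟩
  have hvR : ∀ i, ‖v i‖ ≤ ∑ i, ‖v i‖ := fun i =>
    Finset.single_le_sum (f := fun i => ‖v i‖) (fun _ _ => norm_nonneg _) (Finset.mem_univ i)
  have htop : Submodule.span ℝ (latBall (matLat g.1) (∑ i, ‖v i‖)) = ⊤ := by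
    rw [eq_top_iff]
    rintro x -
    obtain ⟨c, rfl⟩ := rowMap_surjective g x
    have hc : c = ∑ i, c i • intVec (Pi.single i (1 : ℤ)) := by
      funext j
      simp [intVec_apply, Finset.sum_apply, Pi.single_apply]
    rw [hc, map_sum]
    refine Submodule.sum_mem _ fun i _ => ?_
    rw [map_smul]
    exact Submodule.smul_mem _ _ (Submodule.subset_span ⟨⟨_, rfl⟩, hvR i⟩)
  rw [latRank, htop, finrank_top, finrank_euclideanSpace_fin]

lemma measurePreserving_vecMul (g : SLR n) :
    MeasurePreserving (fun c : Fin n → ℝ => c ᵥ* g.1) := by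
  have hdet : (g.1ᵀ).det = 1 := by rw [det_transpose, g.2]
  have h := Real.map_matrix_volume_pi_eq_smul_volume_pi (M := g.1ᵀ)
    (by rw [hdet]; exact one_ne_zero)
  have he : (fun c : Fin n → ℝ => c ᵥ* g.1)
      = toLin' (g.1ᵀ) := by
    funext c
    rw [toLin'_apply, mulVec_transpose]
  refine ⟨by rw [he]; exact (LinearMap.continuous_of_finiteDimensional _).measurable, ?_⟩
  rw [he, h, hdet]
  simp

lemma measurePreserving_rowMap (g : SLR n) :
    MeasurePreserving (rowMap g.1) :=
  (PiLp.volume_preserving_toLp (Fin n)).comp (measurePreserving_vecMul g)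

lemma exists_latPhi_matLat_le :
    ∃ P : ℝ, ∀ g : SLR n, latPhi n (matLat g.1) ≤ P := by
  refine ⟨2 ^ n * (volume.real (Metric.closedBall (0 : 𝔼) 1) + 1), fun g => ?_⟩
  set s : Set (Fin n → ℝ) := rowMap g.1 ⁻¹' Metric.closedBall 0 1 with hs
  have hvol : volume.real s = volume.real (Metric.closedBall (0 : 𝔼) 1) := by
    rw [measureReal_def, measureReal_def,
      (measurePreserving_rowMap g).measure_preimage measurableSet_closedBall.nullMeasurableSet]
  have hconv : Convex ℝ s := (convex_closedBall _ _).linear_preimage _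
  obtain ⟨C, hC, hCb⟩ := exists_abs_le_norm_rowMap g
  have hbdd : Bornology.IsBounded s := by
    refine (Metric.isBounded_closedBall (x := (0 : Fin n → ℝ)) (r := C)).subset fun c hc => ?_
    rw [mem_closedBall_zero_iff, pi_norm_le_iff_of_nonneg hC]
    intro i
    have h1 : ‖rowMap g.1 c‖ ≤ 1 := by simpa [hs] using hc
    exact (hCb c i).trans (mul_le_of_le_one_right hC h1)
  have hmeas : MeasurableSet s := (measurePreserving_rowMap g).measurable measurableSet_closedBall
  have h := tendsto_ncard_intPoints hbdd hmeas (hconv.addHaar_frontier volume)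
  rw [hvol, Fintype.card_fin] at h
  obtain ⟨N, hN, hN0⟩ := ((h.eventually_lt_const (lt_add_one _)).and
    (Filter.eventually_gt_atTop 0)).exists
  have hN' : (0 : ℝ) < N := by exact_mod_cast hN0
  refine (latPhi_le (locFin_matLat g) n hN').trans ?_
  refine mul_le_mul_of_nonneg_left ?_ (by positivity)
  rw [latCount_matLat]
  convert hN.le using 4
  ext m
  have e : (fun i => (N : ℝ)⁻¹ * (m i : ℝ)) = (N : ℝ)⁻¹ • intVec m := rfl
  simp only [Set.mem_ofPred_eq, e, hs, Set.mem_preimage, mem_closedBall_zero_iff, map_smul, norm_smul]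
  rw [Real.norm_of_nonneg (by positivity), inv_mul_le_iff₀ hN', mul_one]

end MatrixLattices

section Moments

/-- A nonnegative function which is contracted on average by measure preserving maps is
integrable. -/
lemma integrable_of_average_contraction {X : Type*} [MeasurableSpace X] {μ : Measure X}
    [IsProbabilityMeasure μ] {f : X → ℝ} (hf : Measurable f) (hf0 : ∀ x, 0 ≤ f x) {N : ℕ}
    {w : ℕ → ℝ} (hw : ∀ j, 0 ≤ w j) (hw1 : ∑ j ∈ Finset.range N, w j = 1) {T : ℕ → X → X}
    (hT : ∀ j, MeasurePreserving (T j) μ μ) {b : ℝ}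
    (h : ∀ x, ∑ j ∈ Finset.range N, w j * f (T j x) ≤ 1 / 2 * f x + b) : Integrable f μ := by
  have hInt : ∀ (g : X → ℝ), Measurable g → (∀ x, 0 ≤ g x) → ∀ M : ℕ,
      Integrable (fun x => min (g x) M) μ := fun g hg hg0 M =>
    Integrable.of_bound (hg.min measurable_const).aestronglyMeasurable M
      (Filter.Eventually.of_forall fun x => by
        rw [Real.norm_of_nonneg (le_min (hg0 x) (Nat.cast_nonneg _))]
        exact min_le_right _ _)
  set b' := max b 0 with hb'
  have hhalf : Measurable fun x => 1 / 2 * f x := hf.const_mul _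
  have hhalf0 : ∀ x, 0 ≤ 1 / 2 * f x := fun x => by have := hf0 x; positivity
  have hbound : ∀ M : ℕ, ∫ x, (min (f x) M - min (1 / 2 * f x) M) ∂μ ≤ b' := by
    intro M
    rw [integral_sub (hInt f hf hf0 M) (hInt _ hhalf hhalf0 M), sub_le_iff_le_add]
    have h1 : ∀ j, ∫ x, min (f (T j x)) M ∂μ = ∫ x, min (f x) M ∂μ := fun j =>
      (integral_map (hT j).measurable.aemeasurable
        (by rw [(hT j).map_eq]; exact (hInt f hf hf0 M).1)).symm.trans (by rw [(hT j).map_eq])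
    have hi : ∀ j, Integrable (fun x => w j * min (f (T j x)) M) μ := fun j =>
      (hInt _ (hf.comp (hT j).measurable) (fun x => hf0 _) M).const_mul _
    calc ∫ x, min (f x) M ∂μ = ∑ j ∈ Finset.range N, w j * ∫ x, min (f (T j x)) M ∂μ := by
          simp_rw [h1, ← Finset.sum_mul, hw1, one_mul]
      _ = ∫ x, ∑ j ∈ Finset.range N, w j * min (f (T j x)) M ∂μ := by
          rw [integral_finsetSum _ fun j _ => hi j]
          simp_rw [integral_const_mul]
      _ ≤ ∫ x, (b' + min (1 / 2 * f x) M) ∂μ := by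
          refine integral_mono (integrable_finsetSum _ fun j _ => hi j)
            ((integrable_const _).add (hInt _ hhalf hhalf0 M)) fun x => ?_
          have hM : (0 : ℝ) ≤ M := Nat.cast_nonneg _
          have hb0 : 0 ≤ b' := le_max_right _ _
          have hbb : b ≤ b' := le_max_left _ _
          rw [← min_add_add_left]
          refine le_min ?_ ?_
          · refine (Finset.sum_le_sum fun j _ =>
              mul_le_mul_of_nonneg_left (min_le_left _ _) (hw j)).trans ?_
            linarith [h x]
          · refine (Finset.sum_le_sum fun j _ =>
              mul_le_mul_of_nonneg_left (min_le_right _ _) (hw j)).trans ?_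
            rw [← Finset.sum_mul, hw1]
            linarith
      _ = _ := by
          rw [integral_add (integrable_const _) (hInt _ hhalf hhalf0 M)]
          simp
  have hg0 : ∀ x (M : ℕ), 0 ≤ min (f x) M - min (1 / 2 * f x) M := fun x M =>
    sub_nonneg.2 (min_le_min_right _ (by linarith [hf0 x]))
  have hgm : ∀ M : ℕ, Measurable fun x => min (f x) (M : ℝ) - min (1 / 2 * f x) M := fun M =>
    (hf.min measurable_const).sub (hhalf.min measurable_const)
  have hlim : ∀ x, Filter.liminf (fun M : ℕ => ENNReal.ofReal (min (f x) M - min (1 / 2 * f x) M))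
      Filter.atTop = ENNReal.ofReal (1 / 2 * f x) := by
    intro x
    refine Filter.Tendsto.liminf_eq (tendsto_const_nhds.congr' ?_)
    obtain ⟨M₀, hM₀⟩ := exists_nat_ge (f x)
    filter_upwards [Filter.eventually_ge_atTop M₀] with M hM
    have hM' : f x ≤ M := hM₀.trans (by exact_mod_cast hM)
    rw [min_eq_left hM', min_eq_left (by linarith [hf0 x])]
    congr 1
    ring
  have hfat : ∫⁻ x, ENNReal.ofReal (1 / 2 * f x) ∂μ ≤ ENNReal.ofReal b' := by
    calc _ = ∫⁻ x, Filter.liminf (fun M : ℕ =>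
            ENNReal.ofReal (min (f x) M - min (1 / 2 * f x) M)) Filter.atTop ∂μ := by simp_rw [hlim]
      _ ≤ Filter.liminf (fun M : ℕ =>
            ∫⁻ x, ENNReal.ofReal (min (f x) M - min (1 / 2 * f x) M) ∂μ) Filter.atTop :=
          lintegral_liminf_le fun M => (hgm M).ennreal_ofReal
      _ ≤ Filter.liminf (fun _ : ℕ => ENNReal.ofReal b') Filter.atTop := by
          refine Filter.liminf_le_liminf (Filter.Eventually.of_forall fun M => ?_)
          exact (ofReal_integral_eq_lintegral_ofReal
            ((hInt f hf hf0 M).sub (hInt _ hhalf hhalf0 M))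
            (Filter.Eventually.of_forall fun x => hg0 x M)).symm.trans_le
            (ENNReal.ofReal_le_ofReal (hbound M))
      _ = _ := Filter.liminf_const _
  have h2 : Integrable (fun x => 1 / 2 * f x) μ := by
    refine ⟨hhalf.aestronglyMeasurable, ?_⟩
    rw [hasFiniteIntegral_iff_ofReal (Filter.Eventually.of_forall hhalf0)]
    exact hfat.trans_lt ENNReal.ofReal_lt_top
  refine (h2.const_mul 2).congr (Filter.Eventually.of_forall fun x => ?_)
  simp only
  ring

end Moments

section LatticeSpace

variable {n : ℕ}

local notation "𝔼" => EuclideanSpace ℝ (Fin n)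

lemma exists_int_mul_of_rightRel {g g' : SLR n} (h : QuotientGroup.rightRel (SLZ n) g g') :
    ∃ γ : SpecialLinearGroup (Fin n) ℤ,
      g'.1 = γ.1.map (Int.castRingHom ℝ) * g.1 := by
  obtain ⟨γ, hγ⟩ := QuotientGroup.rightRel_apply.1 h
  refine ⟨γ, ?_⟩
  have h2 : g' = SpecialLinearGroup.map (Int.castRingHom ℝ) γ * g := by rw [hγ]; simp
  exact congrArg Subtype.val h2

lemma intVec_vecMul (m : Fin n → ℤ) (γ : Matrix (Fin n) (Fin n) ℤ) :
    intVec (m ᵥ* γ) = intVec m ᵥ* γ.map (Int.castRingHom ℝ) := by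
  funext j
  simp [intVec_apply, vecMul, dotProduct]

lemma SLZ_val_mul_inv (γ : SpecialLinearGroup (Fin n) ℤ) : γ.1 * γ⁻¹.1 = 1 :=
  congrArg Subtype.val (mul_inv_cancel γ)

lemma SLZ_val_inv_mul (γ : SpecialLinearGroup (Fin n) ℤ) : γ⁻¹.1 * γ.1 = 1 :=
  congrArg Subtype.val (inv_mul_cancel γ)

/-- Right multiplication by a unimodular matrix. -/
def intVecMulEquiv (γ : SpecialLinearGroup (Fin n) ℤ) : (Fin n → ℤ) ≃ (Fin n → ℤ) where
  toFun m := m ᵥ* γ.1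
  invFun m := m ᵥ* γ⁻¹.1
  left_inv m := by simp only [vecMul_vecMul, SLZ_val_mul_inv, vecMul_one]
  right_inv m := by simp only [vecMul_vecMul, SLZ_val_inv_mul, vecMul_one]

lemma matLat_eq_of_rightRel {g g' : SLR n} (h : QuotientGroup.rightRel (SLZ n) g g') :
    matLat g.1 = matLat g'.1 := by
  obtain ⟨γ, hγ⟩ := exists_int_mul_of_rightRel h
  have hm : ∀ m, rowMap g'.1 (intVec m) = rowMap g.1 (intVec (intVecMulEquiv γ m)) := fun m => by
    rw [rowMap_apply, rowMap_apply, hγ, ← vecMul_vecMul, ← intVec_vecMul]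
    rfl
  ext x
  simp only [mem_matLat, hm]
  exact ((intVecMulEquiv γ).surjective.exists (p := fun m => rowMap g.1 (intVec m) = x))

/-- The lattice corresponding to a point of the space of lattices. -/
noncomputable def latOf : LatSpace n → AddSubgroup 𝔼 :=
  Quotient.lift (fun g : SLR n => matLat g.1) fun _ _ h => matLat_eq_of_rightRel h

lemma latOf_latMk (g : SLR n) : latOf (latMk n g) = matLat g.1 := rfl

lemma latMk_surjective (x : LatSpace n) : ∃ g : SLR n, latMk n g = x := Quotient.exists_rep x

lemma rTranslate_latMk (a g : SLR n) : rTranslate n a (latMk n g) = latMk n (g * a) := rfl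

lemma measurable_latSpace {β : Type*} [MeasurableSpace β] {F : LatSpace n → β}
    (h : Measurable fun g : SLR n => F (latMk n g)) : Measurable F :=
  measurable_from_quotient.2 h

lemma measurable_latMk : Measurable (latMk n) :=
  (measurable_from_quotient (s := QuotientGroup.rightRel (SLZ n))
    (f := (id : LatSpace n → LatSpace n))).1 measurable_id

lemma measurable_SLR_val :
    Measurable (β := Fin n → Fin n → ℝ) fun g : SLR n => g.1 :=
  comap_measurable _

lemma measurable_SLR_entry (i j : Fin n) : Measurable fun g : SLR n => g.1 i j :=
  (measurable_pi_apply j).comp ((measurable_pi_apply i).comp measurable_SLR_val)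

lemma measurable_SLR_mul (a : SLR n) : Measurable fun g : SLR n => g * a := by
  refine measurable_comap_iff.2 (measurable_pi_lambda _ fun i => measurable_pi_lambda _ fun j => ?_)
  have h : ∀ g : SLR n, (g * a).1 i j = ∑ l, g.1 i l * a.1 l j := fun g => rfl
  change Measurable fun g : SLR n => (g * a).1 i j
  simp only [h]
  exact Finset.measurable_sum _ fun l _ => (measurable_SLR_entry i l).mul_const _

lemma measurable_rTranslate (a : SLR n) : Measurable (rTranslate n a) :=
  measurable_latSpace (measurable_latMk.comp (measurable_SLR_mul a))

lemma measurable_SLR_vecMul (c : Fin n → ℝ) : Measurable fun g : SLR n => c ᵥ* g.1 := by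
  refine measurable_pi_lambda _ fun j => ?_
  simp only [vecMul, dotProduct]
  exact Finset.measurable_sum _ fun l _ => (measurable_SLR_entry l j).const_mul _

lemma measurable_SLR_rowMap (c : Fin n → ℝ) : Measurable fun g : SLR n => rowMap g.1 c :=
  (WithLp.measurable_toLp 2 _).comp (measurable_SLR_vecMul c)

lemma measurable_latCount (R : ℝ) :
    Measurable fun x : LatSpace n => (latCount (latOf x) R : ℝ) := by
  refine measurable_latSpace ?_
  have h : ∀ g : SLR n, (latCount (latOf (latMk n g)) R : ℝ)
      = (∑' m : Fin n → ℤ, {g : SLR n | ‖rowMap g.1 (intVec m)‖ ≤ R}.indicator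
          (1 : SLR n → ENNReal) g).toReal := by
    intro g
    rw [latOf_latMk, latCount_matLat, Set.ncard]
    have := ENNReal.tsum_set_one {m : Fin n → ℤ | ‖rowMap g.1 (intVec m)‖ ≤ R}
    rw [tsum_subtype _ (fun _ => (1 : ENNReal))] at this
    have e : ∀ m : Fin n → ℤ, {g : SLR n | ‖rowMap g.1 (intVec m)‖ ≤ R}.indicator
          (1 : SLR n → ENNReal) g
        = {m : Fin n → ℤ | ‖rowMap g.1 (intVec m)‖ ≤ R}.indicator (fun _ => 1) m := fun m => by
      simp only [Set.indicator_apply, Set.mem_ofPred_eq, Pi.one_apply]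
    simp only [e]
    rw [this, ← (finite_rowMap_le g R).cast_ncard_eq]
    simp
  simp only [h]
  refine (Measurable.tsum fun m => ?_).ennreal_toReal
  exact measurable_one.indicator (measurableSet_le (measurable_SLR_rowMap _).norm measurable_const)

lemma measurable_latPhi (i : ℕ) : Measurable fun x : LatSpace n => latPhi i (latOf x) :=
  Measurable.iInf fun _ => (measurable_latCount _).div_const _

/-- The matrix of the contraction `contr`. -/
noncomputable def contrMat (t τ : ℝ) (i₀ : Fin n) (ξ : 𝔼) : Matrix (Fin n) (Fin n) ℝ :=
  t • updateRow 1 i₀ (Pi.single i₀ 1 - ((1 - τ) / ξ i₀) • WithLp.ofLp ξ)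

lemma det_contrMat {t τ : ℝ} (h : t ^ n * τ = 1) (i₀ : Fin n) {ξ : 𝔼} (hξ : ξ i₀ ≠ 0) :
    (contrMat t τ i₀ ξ).det = 1 := by
  rw [contrMat, det_smul, ← cramer_transpose_apply, transpose_one, cramer_one, Fintype.card_fin]
  simp [div_mul_cancel₀ _ hξ, h]

lemma rowMap_contrMat {t τ : ℝ} {i₀ : Fin n} {ξ : 𝔼} (c : Fin n → ℝ) :
    rowMap (contrMat t τ i₀ ξ) c
      = contr t τ (EuclideanSpace.single i₀ 1) ξ (WithLp.toLp 2 c) := by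
  ext j
  rw [rowMap_apply, contr_apply, contrMat, vecMul_smul]
  simp only [contrCoeff, PiLp.smul_apply, PiLp.sub_apply, Pi.smul_apply, smul_eq_mul]
  congr 1
  have h1 : updateRow (1 : Matrix (Fin n) (Fin n) ℝ) i₀
        (Pi.single i₀ 1 - ((1 - τ) / ξ i₀) • WithLp.ofLp ξ)
      = 1 - Matrix.of (fun i j => if i = i₀ then (1 - τ) / ξ i₀ * ξ j else 0) := by
    ext i j
    rw [updateRow_apply]
    by_cases hi : i = i₀
    · subst hi; simp [one_apply, Pi.single_apply, eq_comm]
    · simp [hi]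
  rw [h1, vecMul_sub, vecMul_one]
  rw [EuclideanSpace.inner_single_left, EuclideanSpace.inner_single_left]
  simp [vecMul, dotProduct]
  ring

lemma latOf_rTranslate (a : SLR n) (x : LatSpace n) {t τ : ℝ} {i₀ : Fin n} {ξ : 𝔼}
    (ha : a.1 = contrMat t τ i₀ ξ) :
    latOf (rTranslate n a x) = contrLat t τ (EuclideanSpace.single i₀ 1) ξ (latOf x) := by
  obtain ⟨g, rfl⟩ := latMk_surjective x
  have h : ∀ c, rowMap (g * a).1 c
      = contr t τ (EuclideanSpace.single i₀ 1) ξ (rowMap g.1 c) := fun c => by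
    rw [rowMap_apply g.1, ← rowMap_contrMat, ← ha, rowMap_apply, rowMap_apply, vecMul_vecMul]
    rfl
  rw [rTranslate_latMk, latOf_latMk, latOf_latMk, contrLat]
  ext y
  rw [mem_matLat, AddSubgroup.mem_map]
  simp only [h, mem_matLat, exists_exists_eq_and]
  rfl

/-- The number of lattice points in a ball has finite moments of order less than `n`. -/
lemma integrable_latCount_pow {k : ℕ} (hk : 0 < k) (hkn : k < n) (μ : Measure (LatSpace n))
    [IsProbabilityMeasure μ] (hinv : ∀ a : SLR n, μ.map (rTranslate n a) = μ) {r : ℝ}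
    (hr : 0 < r) : Integrable (fun x => (latCount (latOf x) r : ℝ) ^ k) μ := by
  let i₀ : Fin n := ⟨0, hk.trans hkn⟩
  obtain ⟨P, hP⟩ := exists_latPhi_matLat_le (n := n)
  obtain ⟨t, τ, N, ξ, w, ε, b, ht, hτ, hτ1, htτ, hξ, hw, hw1, hε, H⟩ :=
    exists_lyapunov hk hkn (e := EuclideanSpace.single i₀ (1 : ℝ)) (by simp) (P := P)
  have hloc : ∀ x : LatSpace n, LocFin (latOf x) := fun x => by
    obtain ⟨g, rfl⟩ := latMk_surjective x
    exact locFin_matLat g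
  have hspan : ∀ x : LatSpace n, ∃ R, n ≤ latRank (latOf x) R := fun x => by
    obtain ⟨g, rfl⟩ := latMk_surjective x
    exact exists_le_latRank_matLat g
  have hPx : ∀ x : LatSpace n, latPhi n (latOf x) ≤ P := fun x => by
    obtain ⟨g, rfl⟩ := latMk_surjective x
    exact hP g
  have hξ0 : ∀ j, ξ j i₀ ≠ 0 := fun j h => by
    have := (hξ j).1
    rw [EuclideanSpace.inner_single_left] at this
    simp [h] at this
    linarith
  let a : ℕ → SLR n := fun j => ⟨contrMat t τ i₀ (ξ j), det_contrMat htτ i₀ (hξ0 j)⟩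
  have hterm : ∀ i, Measurable fun x : LatSpace n => latPhi i (latOf x) ^ k := fun i =>
    (measurable_latPhi i).pow_const _
  have hterm0 : ∀ i (x : LatSpace n), 0 ≤ latPhi i (latOf x) ^ k := fun i x =>
    pow_nonneg (latPhi_nonneg _ _) _
  have hLyap : Integrable (fun x : LatSpace n => latLyap n k ε (latOf x)) μ := by
    refine integrable_of_average_contraction (T := fun j => rTranslate n (a j)) (b := b) ?_ ?_ hw hw1
      (fun j => ⟨measurable_rTranslate _, hinv _⟩) fun x => ?_
    · exact Finset.measurable_sum _ fun i _ => (hterm i).const_mul _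
    · exact fun x => Finset.sum_nonneg fun i _ => mul_nonneg (by positivity) (hterm0 i x)
    · have := H (latOf x) (hloc x) (hspan x) (hPx x)
      simpa only [latOf_rTranslate (a _) x rfl] using this
  have hphi : ∀ i ≤ n, Integrable (fun x : LatSpace n => latPhi i (latOf x) ^ k) μ := by
    intro i hi
    rcases Nat.eq_zero_or_pos i with rfl | hi0
    · refine Integrable.of_bound (hterm 0).aestronglyMeasurable 1
        (Filter.Eventually.of_forall fun x => ?_)
      rw [Real.norm_of_nonneg (hterm0 0 x)]
      exact pow_le_one₀ (latPhi_nonneg _ _) (latPhi_zero_le (hloc x))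
    · rcases hi.lt_or_eq with hin | rfl
      · refine (hLyap.const_mul (ε ^ (i * (n - i)))⁻¹).mono' (hterm i).aestronglyMeasurable
          (Filter.Eventually.of_forall fun x => ?_)
        rw [Real.norm_of_nonneg (hterm0 i x), le_inv_mul_iff₀ (by positivity)]
        exact Finset.single_le_sum (f := fun i => ε ^ (i * (n - i)) * latPhi i (latOf x) ^ k)
          (fun i _ => mul_nonneg (by positivity) (hterm0 i x)) (Finset.mem_Ico.2 ⟨hi0, hin⟩)
      · refine Integrable.of_bound (hterm i).aestronglyMeasurable (P ^ k)
          (Filter.Eventually.of_forall fun x => ?_)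
        rw [Real.norm_of_nonneg (hterm0 i x)]
        exact pow_le_pow_left₀ (latPhi_nonneg _ _) (hPx x) _
  refine Integrable.mono' (g := fun x : LatSpace n => ∑ i ∈ Finset.range (n + 1),
    (latConst n * r ^ i) ^ k * latPhi i (latOf x) ^ k)
    (integrable_finsetSum _ fun i hi =>
      (hphi i (Nat.lt_succ_iff.1 (Finset.mem_range.1 hi))).const_mul _)
    ((measurable_latCount r).pow_const k).aestronglyMeasurable
    (Filter.Eventually.of_forall fun x => ?_)
  have hC := one_le_latConst n
  rw [Real.norm_of_nonneg (by positivity)]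
  have h1 := latCount_le_latPhi (hloc x) hr
  rw [finrank_euclideanSpace_fin] at h1
  have hrk : latRank (latOf x) r ≤ n :=
    (Submodule.finrank_le _).trans finrank_euclideanSpace_fin.le
  refine (pow_le_pow_left₀ (by positivity) h1 k).trans ?_
  rw [mul_pow]
  exact Finset.single_le_sum (f := fun i => (latConst n * r ^ i) ^ k * latPhi i (latOf x) ^ k)
    (fun i _ => mul_nonneg (by positivity) (hterm0 i x))
    (Finset.mem_range.2 (Nat.lt_succ_iff.2 hrk))

end LatticeSpace

section Tuples

variable {n h : ℕ}

/-- Right multiplication of a tuple of row vectors by a matrix. -/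
def tupMul (x : Fin h → Fin n → ℝ) (g : Matrix (Fin n) (Fin n) ℝ) : Fin h → Fin n → ℝ :=
  fun a => x a ᵥ* g

/-- The square block of a tuple given by the columns in the range of `ι`. -/
def tupBlock (ι : Fin h ↪ Fin n) (x : Fin h → Fin n → ℝ) : Matrix (Fin h) (Fin h) ℝ :=
  Matrix.of fun a b => x a (ι b)

lemma continuous_tupBlock_det (ι : Fin h ↪ Fin n) :
    Continuous fun x : Fin h → Fin n → ℝ => (tupBlock ι x).det := by
  refine Continuous.matrix_det (continuous_matrix fun a b => ?_)
  exact continuous_apply_apply _ _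

/-- The tuples for which the block of columns given by `ι` is invertible. -/
def tupGood (ι : Fin h ↪ Fin n) : Set (Fin h → Fin n → ℝ) := {x | (tupBlock ι x).det ≠ 0}

lemma isOpen_tupGood (ι : Fin h ↪ Fin n) : IsOpen (tupGood ι) :=
  isOpen_ne_fun (continuous_tupBlock_det ι) continuous_const

lemma measurableSet_tupGood (ι : Fin h ↪ Fin n) : MeasurableSet (tupGood ι) :=
  (isOpen_tupGood ι).measurableSet

lemma ae_mem_tupGood (ι : Fin h ↪ Fin n) : ∀ᵐ x : Fin h → Fin n → ℝ, x ∈ tupGood ι := by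
  let J : Fin h → Fin n → ℝ := fun a => Pi.single (ι a) 1
  refine ae_mem_of_ae_add_linearMap_mem (LinearMap.toSpanSingleton ℝ _ J) volume volume
    (measurableSet_tupGood ι) fun x => ?_
  have hb : ∀ t : ℝ, (tupBlock ι (x + LinearMap.toSpanSingleton ℝ _ J t)).det
      = (-tupBlock ι x).charpoly.eval t := by
    intro t
    rw [eval_charpoly]
    congr 1
    ext a b
    simp [tupBlock, J, Pi.single_apply, diagonal_apply, eq_comm, add_comm]
  refine (Set.Finite.countable (s := {t | (-tupBlock ι x).charpoly.IsRoot t}) ?_).ae_notMem volume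
    |>.mono fun t ht => ?_
  · exact Polynomial.finite_setOfPred_isRoot (charpoly_monic _).ne_zero
  · simp only [tupGood, Set.mem_ofPred_eq, hb]
    exact ht

lemma measurePreserving_uncurry : MeasurePreserving
    (fun (x : Fin h → Fin n → ℝ) (p : Fin h × Fin n) => x p.1 p.2) := by
  have hm : Measurable (fun (x : Fin h → Fin n → ℝ) (p : Fin h × Fin n) => x p.1 p.2) :=
    measurable_pi_lambda _ fun p => (measurable_pi_apply p.2).comp (measurable_pi_apply p.1)
  refine ⟨hm, (Measure.pi_eq fun s hs => ?_).symm⟩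
  rw [Measure.map_apply hm (MeasurableSet.univ_pi hs)]
  have : (fun (x : Fin h → Fin n → ℝ) (p : Fin h × Fin n) => x p.1 p.2) ⁻¹' Set.univ.pi s
      = Set.univ.pi fun a => Set.univ.pi fun j => s (a, j) := by
    ext x
    simp [Set.mem_pi]
  rw [this, volume_pi_pi, Fintype.prod_prod_type]
  simp_rw [volume_pi_pi]

lemma measurePreserving_curry : MeasurePreserving
    (fun (c : Fin h × Fin n → ℝ) (a : Fin h) (j : Fin n) => c (a, j)) := by
  have hm : Measurable (fun (c : Fin h × Fin n → ℝ) (a : Fin h) (j : Fin n) => c (a, j)) :=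
    measurable_pi_lambda _ fun a => measurable_pi_lambda _ fun j => measurable_pi_apply (a, j)
  refine ⟨hm, ?_⟩
  rw [← (measurePreserving_uncurry (n := n) (h := h)).map_eq,
    Measure.map_map hm measurePreserving_uncurry.measurable]
  exact Measure.map_id

/-- Replacing one column of a tuple. -/
def setCol (l : Fin n) (x : Fin h → Fin n → ℝ) (v : Fin h → ℝ) : Fin h → Fin n → ℝ :=
  fun a => Function.update (x a) l (v a)

/-- The matrix adding a combination of the columns in the range of `ι` to the column `l`. -/
def shearMat (ι : Fin h ↪ Fin n) (l : Fin n) (s : Fin h → ℝ) : Matrix (Fin n) (Fin n) ℝ :=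
  updateCol 1 l (Pi.single l 1 + ∑ b, s b • Pi.single (ι b) 1)

variable {ι : Fin h ↪ Fin n} {l : Fin n}

lemma det_shearMat (hl : ∀ b, ι b ≠ l) (s : Fin h → ℝ) : (shearMat ι l s).det = 1 := by
  rw [shearMat, ← cramer_apply, cramer_one]
  simp [Finset.sum_apply, fun b => (hl b).symm]

lemma tupMul_shearMat (s : Fin h → ℝ) (x : Fin h → Fin n → ℝ) :
    tupMul x (shearMat ι l s) = setCol l x (fun a => x a l + (tupBlock ι x *ᵥ s) a) := by
  funext a j
  rw [tupMul, setCol, Function.update_apply]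
  simp only [vecMul, dotProduct, shearMat, updateCol_apply]
  split_ifs with hj
  · simp [Finset.sum_apply, mul_add, Finset.sum_add_distrib, Finset.mul_sum, Pi.single_apply,
      tupBlock, mulVec, dotProduct]
    rw [Finset.sum_comm]
    simp [mul_comm]
  · simp [one_apply]

lemma tupBlock_setCol (hl : ∀ b, ι b ≠ l) (x : Fin h → Fin n → ℝ) (v : Fin h → ℝ) :
    tupBlock ι (setCol l x v) = tupBlock ι x := by
  ext a b
  simp [tupBlock, setCol, Function.update_of_ne (hl b)]

lemma setCol_setCol (x : Fin h → Fin n → ℝ) (v w : Fin h → ℝ) :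
    setCol l (setCol l x v) w = setCol l x w := by
  funext a
  simp [setCol]

lemma setCol_apply_self (x : Fin h → Fin n → ℝ) (v : Fin h → ℝ) (a : Fin h) :
    setCol l x v a l = v a := by simp [setCol]

/-- The coefficients of the column `l` in terms of the columns in the range of `ι`. -/
noncomputable def colCoeff (ι : Fin h ↪ Fin n) (l : Fin n) (x : Fin h → Fin n → ℝ) : Fin h → ℝ :=
  (tupBlock ι x).det⁻¹ • ((tupBlock ι x).adjugate *ᵥ fun a => x a l)

lemma measurable_colCoeff : Measurable (colCoeff ι l) := by
  refine (continuous_tupBlock_det ι).measurable.inv.smul (Continuous.measurable ?_)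
  refine Continuous.matrix_mulVec (Continuous.matrix_adjugate (continuous_matrix fun a b => ?_))
    (continuous_pi fun a => ?_)
  · exact continuous_apply_apply _ _
  · exact continuous_apply_apply _ _

lemma tupBlock_mulVec_colCoeff {x : Fin h → Fin n → ℝ} (hx : x ∈ tupGood ι) :
    tupBlock ι x *ᵥ colCoeff ι l x = fun a => x a l := by
  rw [colCoeff, mulVec_smul, mulVec_mulVec, mul_adjugate, smul_mulVec, one_mulVec, smul_smul,
    inv_mul_cancel₀ hx, one_smul]

lemma colCoeff_setCol (hl : ∀ b, ι b ≠ l) {x : Fin h → Fin n → ℝ} (hx : x ∈ tupGood ι)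
    (s : Fin h → ℝ) : colCoeff ι l (setCol l x (tupBlock ι x *ᵥ s)) = s := by
  simp only [colCoeff, tupBlock_setCol hl, setCol_apply_self]
  rw [mulVec_mulVec, adjugate_mul, smul_mulVec, one_mulVec, smul_smul, inv_mul_cancel₀ hx, one_smul]

lemma measurable_setCol {X : Type*} [MeasurableSpace X] {x : X → Fin h → Fin n → ℝ}
    {v : X → Fin h → ℝ} (hx : Measurable x) (hv : Measurable v) :
    Measurable fun t => setCol l (x t) (v t) := by
  refine measurable_pi_lambda _ fun a => measurable_pi_lambda _ fun j => ?_
  simp only [setCol, Function.update_apply]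
  split_ifs
  · exact (measurable_pi_apply a).comp hv
  · exact (measurable_pi_apply j).comp ((measurable_pi_apply a).comp hx)

end Tuples

section Scaling

variable {n h : ℕ} {ι : Fin h ↪ Fin n} {l : Fin n}

lemma measurable_tupBlock_mulVec {X : Type*} [MeasurableSpace X] {x : X → Fin h → Fin n → ℝ}
    {v : X → Fin h → ℝ} (hx : Measurable x) (hv : Measurable v) :
    Measurable fun t => tupBlock ι (x t) *ᵥ v t := by
  refine measurable_pi_lambda _ fun a => ?_
  simp only [mulVec, dotProduct, tupBlock, of_apply]
  exact Finset.measurable_sum _ fun b _ => ((measurable_pi_apply (ι b)).comp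
    ((measurable_pi_apply a).comp hx)).mul ((measurable_pi_apply b).comp hv)

lemma measurable_col {X : Type*} [MeasurableSpace X] {x : X → Fin h → Fin n → ℝ}
    (hx : Measurable x) : Measurable fun t a => x t a l :=
  measurable_pi_lambda _ fun a => (measurable_pi_apply l).comp ((measurable_pi_apply a).comp hx)

/-- Integrals over an invariant measure, disintegrated along the orbits of the shears. -/
lemma setLIntegral_eq_lintegral_shear (hl : ∀ b, ι b ≠ l) (Λ : Measure (Fin h → Fin n → ℝ))
    [SFinite Λ] (hΛ : ∀ s, Λ.map (fun x => tupMul x (shearMat ι l s)) = Λ)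
    {F : (Fin h → Fin n → ℝ) → ENNReal} (hF : Measurable F) :
    ∫⁻ x in tupGood ι, F x ∂Λ
      = ∫⁻ x, (tupGood ι ∩ colCoeff ι l ⁻¹' Set.Icc 0 1).indicator 1 x *
          (∫⁻ s : Fin h → ℝ, F (setCol l x (tupBlock ι x *ᵥ s))) ∂Λ := by
  set w : (Fin h → Fin n → ℝ) → ENNReal :=
    (tupGood ι ∩ colCoeff ι l ⁻¹' Set.Icc 0 1).indicator 1 with hw
  have hwm : Measurable w := measurable_one.indicator
    ((measurableSet_tupGood ι).inter (measurable_colCoeff measurableSet_Icc))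
  set sh : (Fin h → ℝ) → (Fin h → Fin n → ℝ) → Fin h → Fin n → ℝ := fun s x =>
    setCol l x (fun a => x a l + (tupBlock ι x *ᵥ s) a) with hsh
  have hshm : Measurable (Function.uncurry sh) :=
    measurable_setCol measurable_snd ((measurable_col measurable_snd).add
      (measurable_tupBlock_mulVec measurable_snd measurable_fst))
  have hshm1 : ∀ s, Measurable (sh s) := fun s => hshm.of_uncurry_left
  have hinv : ∀ s (G : (Fin h → Fin n → ℝ) → ENNReal), Measurable G →
      ∫⁻ x, G x ∂Λ = ∫⁻ x, G (sh s x) ∂Λ := by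
    intro s G hG
    have e : (fun x => tupMul x (shearMat ι l s)) = sh s := funext fun x => tupMul_shearMat s x
    conv_lhs => rw [← hΛ s, e]
    exact lintegral_map hG (hshm1 s)
  have hcancel : ∀ s x, sh s (sh (-s) x) = x := by
    intro s x
    simp only [hsh, tupBlock_setCol hl, setCol_apply_self, setCol_setCol]
    funext a
    simp [setCol, mulVec_neg]
  have hgood : ∀ s x, sh s x ∈ tupGood ι ↔ x ∈ tupGood ι := fun s x => by
    simp only [tupGood, Set.mem_ofPred_eq, hsh, tupBlock_setCol hl]
  have hshx : ∀ s x, x ∈ tupGood ι → sh s x = setCol l x (tupBlock ι x *ᵥ (colCoeff ι l x + s)) := by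
    intro s x hx
    rw [mulVec_add, tupBlock_mulVec_colCoeff hx]
    rfl
  have hw1 : ∀ x, ∫⁻ s, w (sh s x) = (tupGood ι).indicator 1 x := by
    intro x
    by_cases hx : x ∈ tupGood ι
    · have : ∀ s, w (sh s x) = (Set.Icc (0 : Fin h → ℝ) 1).indicator 1 (colCoeff ι l x + s) := by
        intro s
        have h1 : colCoeff ι l (sh s x) = colCoeff ι l x + s := by
          rw [hshx s x hx, colCoeff_setCol hl hx]
        simp only [hw, Set.indicator_apply, Set.mem_inter_iff, (hgood s x).2 hx, true_and,
          Set.mem_preimage, h1, Pi.one_apply]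
      simp_rw [this]
      rw [lintegral_add_left_eq_self, lintegral_indicator_one measurableSet_Icc, Real.volume_Icc_pi,
        Set.indicator_of_mem hx]
      simp
    · have : ∀ s, w (sh s x) = 0 := fun s =>
        Set.indicator_of_notMem (fun hs => hx ((hgood s x).1 hs.1)) _
      simp [this, hx]
  have hFsh : Measurable fun p : (Fin h → Fin n → ℝ) × (Fin h → ℝ) => F (sh (-p.2) p.1) :=
    hF.comp (hshm.comp (measurable_snd.neg.prodMk measurable_fst))
  calc ∫⁻ x in tupGood ι, F x ∂Λ = ∫⁻ x, (∫⁻ s : Fin h → ℝ, F x * w (sh s x)) ∂Λ := by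
        rw [← lintegral_indicator (measurableSet_tupGood ι)]
        refine lintegral_congr fun x => ?_
        have hws : Measurable fun s => w (sh s x) := hwm.comp hshm.of_uncurry_right
        rw [lintegral_const_mul _ hws, hw1]
        by_cases hx : x ∈ tupGood ι <;> simp [hx]
    _ = ∫⁻ s : Fin h → ℝ, (∫⁻ x, F x * w (sh s x) ∂Λ) := by
        refine lintegral_lintegral_swap (Measurable.aemeasurable ?_)
        exact (hF.comp measurable_fst).mul (hwm.comp (hshm.comp measurable_swap))
    _ = ∫⁻ s : Fin h → ℝ, (∫⁻ x, F (sh (-s) x) * w x ∂Λ) := by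
        refine lintegral_congr fun s => ?_
        refine (hinv (-s) (fun x => F x * w (sh s x)) (hF.mul (hwm.comp (hshm1 s)))).trans ?_
        simp only [hcancel]
    _ = ∫⁻ x, (∫⁻ s : Fin h → ℝ, F (sh (-s) x) * w x) ∂Λ := by
        refine (lintegral_lintegral_swap (Measurable.aemeasurable ?_)).symm
        exact hFsh.mul (hwm.comp measurable_fst)
    _ = _ := by
        refine lintegral_congr fun x => ?_
        have hFs : Measurable fun s => F (sh (-s) x) := hFsh.comp measurable_prodMk_left
        rw [lintegral_mul_const _ hFs, mul_comm]
        by_cases hx : x ∈ tupGood ι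
        · congr 1
          simp_rw [hshx _ x hx, ← sub_eq_add_neg]
          exact lintegral_sub_left_eq_self (fun s => F (setCol l x (tupBlock ι x *ᵥ s))) _
        · simp [hw, hx]

lemma setLIntegral_scaleCol (hl : ∀ b, ι b ≠ l) (Λ : Measure (Fin h → Fin n → ℝ))
    [SFinite Λ] (hΛ : ∀ s, Λ.map (fun x => tupMul x (shearMat ι l s)) = Λ)
    {F : (Fin h → Fin n → ℝ) → ENNReal} (hF : Measurable F) {c : ℝ} (hc : 0 < c) :
    ∫⁻ x in tupGood ι, F (setCol l x (c • fun a => x a l)) ∂Λ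
      = ENNReal.ofReal ((c ^ h)⁻¹) * ∫⁻ x in tupGood ι, F x ∂Λ := by
  have hD : Measurable fun x : Fin h → Fin n → ℝ => setCol l x (c • fun a => x a l) :=
    measurable_setCol measurable_id ((measurable_col measurable_id).const_smul c)
  rw [setLIntegral_eq_lintegral_shear hl Λ hΛ
      (F := fun x => F (setCol l x (c • fun a => x a l))) (hF.comp hD),
    setLIntegral_eq_lintegral_shear hl Λ hΛ hF, ← lintegral_const_mul' _ _ ENNReal.ofReal_ne_top]
  refine lintegral_congr fun x => ?_
  rw [mul_left_comm]
  congr 1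
  have hm : Measurable fun s => F (setCol l x (tupBlock ι x *ᵥ s)) :=
    hF.comp (measurable_setCol measurable_const
      (measurable_tupBlock_mulVec measurable_const measurable_id))
  have h1 := Measure.map_addHaar_smul (volume : Measure (Fin h → ℝ)) hc.ne'
  have h2 := lintegral_map hm (measurable_const_smul c) (μ := (volume : Measure (Fin h → ℝ)))
  rw [h1, lintegral_smul_measure, Module.finrank_fin_fun, abs_of_pos (by positivity)] at h2
  rw [← smul_eq_mul, h2]
  refine lintegral_congr fun s => ?_
  simp only [setCol_setCol, setCol_apply_self, mulVec_smul]

end Scaling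

section MeanMeasure

variable {n : ℕ}

lemma tupMul_tupMul {h : ℕ} (x : Fin h → Fin n → ℝ) (g a : Matrix (Fin n) (Fin n) ℝ) :
    tupMul (tupMul x g) a = tupMul x (g * a) := by
  funext b
  simp [tupMul]

lemma continuous_tupMul {h : ℕ} (g : Matrix (Fin n) (Fin n) ℝ) :
    Continuous fun x : Fin h → Fin n → ℝ => tupMul x g :=
  continuous_pi fun a => Continuous.matrix_vecMul (continuous_apply a) continuous_const

/-- The counting measure of the `h`-tuples of vectors of the lattice `ℤ^n g`. -/
noncomputable def tupMeas (h : ℕ) (g : Matrix (Fin n) (Fin n) ℝ) :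
    Measure (Fin h → Fin n → ℝ) :=
  Measure.sum fun m : Fin h → Fin n → ℤ => Measure.dirac (tupMul (fun a => intVec (m a)) g)

lemma tupMeas_apply_tsum {h : ℕ} (g : Matrix (Fin n) (Fin n) ℝ) {A : Set (Fin h → Fin n → ℝ)}
    (hA : MeasurableSet A) :
    tupMeas h g A
      = ∑' m : Fin h → Fin n → ℤ, A.indicator 1 (tupMul (fun a => intVec (m a)) g) := by
  rw [tupMeas, Measure.sum_apply _ hA]
  exact tsum_congr fun m => Measure.dirac_apply' _ hA

lemma tupMeas_apply {h : ℕ} (g : Matrix (Fin n) (Fin n) ℝ) {A : Set (Fin h → Fin n → ℝ)}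
    (hA : MeasurableSet A) :
    tupMeas h g A
      = ({m : Fin h → Fin n → ℤ | tupMul (fun a => intVec (m a)) g ∈ A}.encard : ENNReal) := by
  rw [tupMeas_apply_tsum g hA, ← ENNReal.tsum_set_one, tsum_subtype
    {m : Fin h → Fin n → ℤ | tupMul (fun a => intVec (m a)) g ∈ A} (fun _ => (1 : ENNReal))]
  rfl

lemma tupMeas_eq_of_rightRel (h : ℕ) {g g' : SLR n} (hg : QuotientGroup.rightRel (SLZ n) g g') :
    tupMeas h g.1 = tupMeas h g'.1 := by
  obtain ⟨γ, hγ⟩ := exists_int_mul_of_rightRel hg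
  ext A hA
  rw [tupMeas_apply_tsum _ hA, tupMeas_apply_tsum _ hA,
    ← (Equiv.piCongrRight fun _ : Fin h => intVecMulEquiv γ).tsum_eq
      fun m => A.indicator (1 : (Fin h → Fin n → ℝ) → ENNReal) (tupMul (fun a => intVec (m a)) g.1)]
  refine tsum_congr fun m => congrArg (A.indicator 1) ?_
  funext a
  simp only [tupMul, hγ, ← vecMul_vecMul, ← intVec_vecMul]
  rfl

/-- The counting measure of the `h`-tuples of vectors of a lattice. -/
noncomputable def tupKer (h : ℕ) : LatSpace n → Measure (Fin h → Fin n → ℝ) :=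
  Quotient.lift (fun g : SLR n => tupMeas h g.1) fun _ _ hg => tupMeas_eq_of_rightRel h hg

lemma tupKer_latMk (h : ℕ) (g : SLR n) : tupKer h (latMk n g) = tupMeas h g.1 := rfl

lemma measurable_tupKer (h : ℕ) : Measurable (tupKer (n := n) h) := by
  refine Measure.measurable_of_measurable_coe _ fun A hA => measurable_latSpace ?_
  simp only [tupKer_latMk, tupMeas_apply_tsum _ hA]
  refine Measurable.tsum fun m => (measurable_one.indicator hA).comp ?_
  exact measurable_pi_lambda _ fun a => measurable_SLR_vecMul _

lemma tupKer_rTranslate (h : ℕ) (a : SLR n) (x : LatSpace n) {A : Set (Fin h → Fin n → ℝ)}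
    (hA : MeasurableSet A) :
    tupKer h (rTranslate n a x) A = tupKer h x ((fun x => tupMul x a.1) ⁻¹' A) := by
  obtain ⟨g, rfl⟩ := latMk_surjective x
  rw [rTranslate_latMk, tupKer_latMk, tupKer_latMk, tupMeas_apply _ hA,
    tupMeas_apply _ ((continuous_tupMul a.1).measurable hA)]
  simp only [Set.mem_preimage, tupMul_tupMul]
  rfl

variable (μ : Measure (LatSpace n)) (h : ℕ)

/-- The mean of the counting measures of the `h`-tuples of lattice vectors. -/
noncomputable def meanTup : Measure (Fin h → Fin n → ℝ) := μ.bind (tupKer h)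

lemma meanTup_apply {A : Set (Fin h → Fin n → ℝ)} (hA : MeasurableSet A) :
    meanTup μ h A = ∫⁻ x, tupKer h x A ∂μ :=
  Measure.bind_apply hA (measurable_tupKer h).aemeasurable

lemma measurable_tupKer_apply {A : Set (Fin h → Fin n → ℝ)} (hA : MeasurableSet A) :
    Measurable fun x : LatSpace n => tupKer h x A :=
  (Measure.measurable_coe hA).comp (measurable_tupKer h)

lemma map_meanTup (hinv : ∀ a : SLR n, μ.map (rTranslate n a) = μ) (a : SLR n) :
    (meanTup μ h).map (fun x => tupMul x a.1) = meanTup μ h := by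
  have hm := (continuous_tupMul (h := h) a.1).measurable
  ext A hA
  rw [Measure.map_apply hm hA, meanTup_apply _ _ hA, meanTup_apply _ _ (hm hA)]
  conv_rhs => rw [← hinv a, lintegral_map (measurable_tupKer_apply h hA) (measurable_rTranslate a)]
  exact lintegral_congr fun x => (tupKer_rTranslate h a x hA).symm

/-- The tuples all of whose vectors have Euclidean length at most `R`. -/
def tupBall (n h : ℕ) (R : ℝ) : Set (Fin h → Fin n → ℝ) :=
  Set.univ.pi fun _ => {x | ‖WithLp.toLp 2 x‖ ≤ R}

lemma measurableSet_tupBall (R : ℝ) : MeasurableSet (tupBall n h R) :=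
  MeasurableSet.univ_pi fun _ =>
    measurableSet_le (WithLp.measurable_toLp 2 _).norm measurable_const

lemma tupKer_tupBall (x : LatSpace n) (R : ℝ) :
    tupKer h x (tupBall n h R) = ENNReal.ofReal ((latCount (latOf x) R : ℝ) ^ h) := by
  obtain ⟨g, rfl⟩ := latMk_surjective x
  rw [tupKer_latMk, latOf_latMk, latCount_matLat, tupMeas_apply _ (measurableSet_tupBall h R)]
  set T := (finite_rowMap_le g R).toFinset with hT
  have e : {m : Fin h → Fin n → ℤ | tupMul (fun a => intVec (m a)) g.1 ∈ tupBall n h R}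
      = ↑(Fintype.piFinset fun _ : Fin h => T) := by
    ext m
    simp [tupBall, hT, tupMul, rowMap_apply]
  rw [e, Set.encard_coe_eq_coe_finsetCard, Fintype.card_piFinset_const,
    Set.ncard_eq_toFinset_card _ (finite_rowMap_le g R), ← Nat.cast_pow,
    ENNReal.ofReal_natCast]
  rfl

variable [IsProbabilityMeasure μ] {h} (hinv : ∀ a : SLR n, μ.map (rTranslate n a) = μ)

include hinv in
lemma meanTup_tupBall_lt_top (hh : 0 < h) (hhn : h < n) {R : ℝ} (hR : 0 < R) :
    meanTup μ h (tupBall n h R) < ⊤ := by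
  rw [meanTup_apply _ _ (measurableSet_tupBall h R)]
  simp only [tupKer_tupBall]
  exact (integrable_latCount_pow hh hhn μ hinv hR).lintegral_lt_top

include hinv in
lemma sigmaFinite_meanTup (hh : 0 < h) (hhn : h < n) : SigmaFinite (meanTup μ h) := by
  refine ⟨⟨⟨fun N => tupBall n h (N + 1), fun _ => trivial,
    fun N => meanTup_tupBall_lt_top μ hinv hh hhn (by positivity), ?_⟩⟩⟩
  refine Set.eq_univ_of_forall fun x => Set.mem_iUnion.2 ?_
  obtain ⟨N, hN⟩ := exists_nat_ge (∑ a, ‖WithLp.toLp 2 (x a)‖)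
  refine ⟨N, fun a _ => ?_⟩
  have := Finset.single_le_sum (f := fun a => ‖WithLp.toLp 2 (x a)‖)
    (fun _ _ => norm_nonneg _) (Finset.mem_univ a)
  simp only [Set.mem_ofPred_eq]
  linarith

/-- The diagonal matrix of determinant one with all entries but one equal to `R⁻¹`. -/
noncomputable def stretchMat (l : Fin n) (R : ℝ) : Matrix (Fin n) (Fin n) ℝ :=
  diagonal (Function.update (fun _ => R⁻¹) l (R ^ (n - 1)))

lemma det_stretchMat (l : Fin n) {R : ℝ} (hR : 0 < R) : (stretchMat l R).det = 1 := by
  rw [stretchMat, det_diagonal, Finset.prod_update_of_mem (Finset.mem_univ l), Finset.prod_const,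
    Finset.card_sdiff]
  simp [hR.ne']

lemma tupMul_stretchMat (l : Fin n) {R : ℝ} (hR : 0 < R) (x : Fin h → Fin n → ℝ) :
    tupMul x (stretchMat l R) = R⁻¹ • setCol l x (R ^ n • fun a => x a l) := by
  have hn : n = (n - 1) + 1 := (Nat.succ_pred_eq_of_pos l.pos).symm
  funext a j
  rw [tupMul, stretchMat, vecMul_diagonal]
  by_cases hj : j = l
  · subst hj
    simp only [Function.update_self, Pi.smul_apply, setCol_apply_self, smul_eq_mul]
    conv_rhs => rw [hn, pow_succ]
    field_simp
  · simp [setCol, Function.update_of_ne hj, mul_comm]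

lemma smul_mem_tupGood {ι : Fin h ↪ Fin n} {R : ℝ} (hR : R ≠ 0) (x : Fin h → Fin n → ℝ) :
    R • x ∈ tupGood ι ↔ x ∈ tupGood ι := by
  have : tupBlock ι (R • x) = R • tupBlock ι x := by ext a b; simp [tupBlock]
  simp [tupGood, this, hR]

include hinv in
lemma meanTup_smul (hh : 0 < h) (hhn : h < n) {ι : Fin h ↪ Fin n} {l : Fin n}
    (hl : ∀ b, ι b ≠ l) {A : Set (Fin h → Fin n → ℝ)} (hA : MeasurableSet A) {R : ℝ}
    (hR : 0 < R) :
    meanTup μ h (tupGood ι ∩ {x | R • x ∈ A})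
      = ENNReal.ofReal (((R ^ n) ^ h)⁻¹) * meanTup μ h (tupGood ι ∩ A) := by
  have := sigmaFinite_meanTup μ hinv hh hhn
  have hRA : MeasurableSet {x : Fin h → Fin n → ℝ | R • x ∈ A} := measurable_const_smul R hA
  have hS : MeasurableSet (tupGood ι ∩ {x | R • x ∈ A}) := (measurableSet_tupGood ι).inter hRA
  have hD : Measurable fun x : Fin h → Fin n → ℝ => setCol l x (R ^ n • fun a => x a l) :=
    measurable_setCol measurable_id
      (Measurable.const_smul (measurable_col (x := fun x => x) measurable_id) (R ^ n))
  have key := setLIntegral_scaleCol hl (meanTup μ h)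
    (fun s => map_meanTup μ h hinv ⟨shearMat ι l s, det_shearMat hl s⟩)
    ((measurable_one (α := ENNReal)).indicator hA) (pow_pos hR n)
  rw [lintegral_indicator_one hA, Measure.restrict_apply hA, Set.inter_comm A] at key
  rw [← key]
  conv_lhs => rw [← map_meanTup μ h hinv ⟨stretchMat l R, det_stretchMat l hR⟩,
    Measure.map_apply (continuous_tupMul _).measurable hS]
  have e : (fun x => tupMul x (stretchMat l R)) ⁻¹' (tupGood ι ∩ {x | R • x ∈ A})
      = (fun x => setCol l x (R ^ n • fun a => x a l)) ⁻¹' A ∩ tupGood ι := by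
    ext x
    simp only [Set.mem_preimage, Set.mem_inter_iff, tupMul_stretchMat l hR, Set.mem_ofPred_eq,
      smul_mem_tupGood (inv_ne_zero hR.ne'), smul_inv_smul₀ hR.ne', and_comm]
    simp only [tupGood, Set.mem_ofPred_eq, tupBlock_setCol hl]
  have e2 : ∀ x, A.indicator (1 : (Fin h → Fin n → ℝ) → ENNReal) (setCol l x (R ^ n • fun a => x a l))
      = ((fun x => setCol l x (R ^ n • fun a => x a l)) ⁻¹' A).indicator 1 x := fun x => rfl
  simp only [e2]
  rw [lintegral_indicator_one (hD hA), Measure.restrict_apply (hD hA), ← e]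

end MeanMeasure

section MeanMeasureLowerBound

variable {n h : ℕ}

lemma measurePreserving_tupMul (g : SLR n) :
    MeasurePreserving fun x : Fin h → Fin n → ℝ => tupMul x g.1 :=
  volume_preserving_pi fun _ => measurePreserving_vecMul g

lemma measurePreserving_tupMul_curry (g : SLR n) :
    MeasurePreserving fun c : Fin h × Fin n → ℝ => tupMul (fun a j => c (a, j)) g.1 :=
  (measurePreserving_tupMul g).comp measurePreserving_curry

lemma continuous_tupMul_curry (g : SLR n) :
    Continuous fun c : Fin h × Fin n → ℝ => tupMul (fun a j => c (a, j)) g.1 :=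
  (continuous_tupMul g.1).comp
    (continuous_pi fun a => continuous_pi fun j => continuous_apply (a, j))

lemma isBounded_preimage_tupMul_curry (g : SLR n) {A : Set (Fin h → Fin n → ℝ)}
    (hA : Bornology.IsBounded A) :
    Bornology.IsBounded ((fun c : Fin h × Fin n → ℝ => tupMul (fun a j => c (a, j)) g.1) ⁻¹' A) := by
  have hc : Continuous fun (x : Fin h → Fin n → ℝ) (p : Fin h × Fin n) =>
      tupMul x g⁻¹.1 p.1 p.2 :=
    continuous_pi fun p => (continuous_apply_apply p.1 p.2).comp (continuous_tupMul g⁻¹.1)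
  refine (hA.isCompact_closure.image hc).isBounded.subset fun c hcA => ⟨_, subset_closure hcA, ?_⟩
  funext p
  simp only [tupMul_tupMul, SLR.val_mul_inv]
  simp [tupMul]

lemma volume_frontier_inter_tupGood (ι : Fin h ↪ Fin n) {A : Set (Fin h → Fin n → ℝ)}
    (hA : volume (frontier A) = 0) : volume (frontier (tupGood ι ∩ A)) = 0 := by
  have h1 : volume (tupGood ι)ᶜ = 0 := ae_mem_tupGood ι
  refine measure_mono_null ((frontier_inter_subset _ _).trans ?_) (measure_union_null h1 hA)
  refine Set.union_subset_union (Set.inter_subset_left.trans fun x hx hx' => ?_)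
    Set.inter_subset_right
  exact hx.2 (by rwa [(isOpen_tupGood ι).interior_eq])

lemma tendsto_tupMeas (g : SLR n) (ι : Fin h ↪ Fin n) {A : Set (Fin h → Fin n → ℝ)}
    (hA : MeasurableSet A) (hb : Bornology.IsBounded A) (hf : volume (frontier A) = 0) :
    Filter.Tendsto (fun N : ℕ => ENNReal.ofReal ((((N : ℝ)⁻¹) ^ n) ^ h) *
      tupMeas h g.1 (tupGood ι ∩ {x | (N : ℝ)⁻¹ • x ∈ A})) Filter.atTop (nhds (volume A)) := by
  set T : (Fin h × Fin n → ℝ) → Fin h → Fin n → ℝ :=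
    fun c => tupMul (fun a j => c (a, j)) g.1 with hT
  set s := T ⁻¹' (tupGood ι ∩ A) with hs
  have hTm : MeasurePreserving T := measurePreserving_tupMul_curry g
  have hTc : Continuous T := continuous_tupMul_curry g
  have hΩA : MeasurableSet (tupGood ι ∩ A) := (measurableSet_tupGood ι).inter hA
  have hsb : Bornology.IsBounded s :=
    isBounded_preimage_tupMul_curry g (hb.subset Set.inter_subset_right)
  have hsf : volume (frontier s) = 0 := by
    refine measure_mono_null (hTc.frontier_preimage_subset _) ?_
    rw [hTm.measure_preimage isClosed_frontier.measurableSet.nullMeasurableSet]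
    exact volume_frontier_inter_tupGood ι hf
  have hsv : volume s = volume A := by
    rw [hTm.measure_preimage hΩA.nullMeasurableSet, Set.inter_comm]
    exact measure_inter_conull (ae_mem_tupGood ι)
  have hlim := ENNReal.tendsto_ofReal
    (tendsto_ncard_intPoints hsb (hTm.measurable hΩA) hsf)
  rw [measureReal_def, ENNReal.ofReal_toReal hsb.measure_lt_top.ne, hsv] at hlim
  refine hlim.congr' ?_
  filter_upwards [Filter.eventually_gt_atTop 0] with N hN
  have hN' : (0 : ℝ) < (N : ℝ)⁻¹ := inv_pos.2 (Nat.cast_pos.2 hN)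
  have hset : {m : Fin h → Fin n → ℤ | tupMul (fun a => intVec (m a)) g.1
      ∈ tupGood ι ∩ {x | (N : ℝ)⁻¹ • x ∈ A}}
      = (Equiv.curry (Fin h) (Fin n) ℤ) ''
        {m : Fin h × Fin n → ℤ | (fun i => (N : ℝ)⁻¹ * (m i : ℝ)) ∈ s} := by
    rw [Equiv.image_eq_preimage_symm]
    ext m
    have e : T (fun i => (N : ℝ)⁻¹ * ((Equiv.curry (Fin h) (Fin n) ℤ).symm m i : ℝ))
        = (N : ℝ)⁻¹ • tupMul (fun a => intVec (m a)) g.1 := by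
      funext a
      simp only [hT, tupMul, Pi.smul_apply]
      rw [← smul_vecMul]
      rfl
    simp only [hs, Set.mem_ofPred_eq, Set.mem_preimage, e, Set.mem_inter_iff,
      smul_mem_tupGood hN'.ne']
  have hfin : {m : Fin h × Fin n → ℤ | (fun i => (N : ℝ)⁻¹ * (m i : ℝ)) ∈ s}.Finite := by
    obtain ⟨C, hC⟩ := hsb.exists_norm_le
    refine (finite_intPoints (N * C)).subset fun m hm i => ?_
    have h1 := (norm_le_pi_norm _ i).trans (hC (fun i => (N : ℝ)⁻¹ * (m i : ℝ)) hm)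
    rw [Real.norm_eq_abs, abs_mul, abs_of_pos hN', inv_mul_le_iff₀ (Nat.cast_pos.2 hN)] at h1
    exact h1
  have hSm : MeasurableSet (tupGood ι ∩ {x | (N : ℝ)⁻¹ • x ∈ A}) :=
    (measurableSet_tupGood ι).inter (measurable_const_smul _ hA)
  rw [tupMeas_apply _ hSm, hset,
    (Equiv.injective _).encard_image, ← hfin.cast_ncard_eq, div_eq_inv_mul,
    ENNReal.ofReal_mul (by positivity), Fintype.card_prod, Fintype.card_fin, Fintype.card_fin,
    ENNReal.ofReal_natCast, ← pow_mul, inv_pow, mul_comm h n]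
  rfl

lemma volume_le_meanTup (μ : Measure (LatSpace n)) [IsProbabilityMeasure μ]
    (hinv : ∀ a : SLR n, μ.map (rTranslate n a) = μ) (hh : 0 < h) (hhn : h < n)
    {ι : Fin h ↪ Fin n} {l : Fin n} (hl : ∀ b, ι b ≠ l) {A : Set (Fin h → Fin n → ℝ)}
    (hA : MeasurableSet A) (hb : Bornology.IsBounded A) (hf : volume (frontier A) = 0) :
    volume A ≤ meanTup μ h (tupGood ι ∩ A) := by
  set S : ℕ → Set (Fin h → Fin n → ℝ) := fun N => tupGood ι ∩ {x | (N : ℝ)⁻¹ • x ∈ A} with hS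
  have hSm : ∀ N, MeasurableSet (S N) := fun N =>
    (measurableSet_tupGood ι).inter (measurable_const_smul _ hA)
  set c : ℕ → ENNReal := fun N => ENNReal.ofReal ((((N : ℝ)⁻¹) ^ n) ^ h) with hc
  have h1 : ∀ x : LatSpace n,
      Filter.liminf (fun N => c N * tupKer h x (S N)) Filter.atTop = volume A := fun x => by
    obtain ⟨g, rfl⟩ := latMk_surjective x
    exact (tendsto_tupMeas g ι hA hb hf).liminf_eq
  calc volume A = ∫⁻ x, Filter.liminf (fun N => c N * tupKer h x (S N)) Filter.atTop ∂μ := by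
        simp [h1]
    _ ≤ Filter.liminf (fun N => ∫⁻ x, c N * tupKer h x (S N) ∂μ) Filter.atTop :=
        lintegral_liminf_le fun N => (measurable_tupKer_apply h (hSm N)).const_mul _
    _ = Filter.liminf (fun _ : ℕ => meanTup μ h (tupGood ι ∩ A)) Filter.atTop := by
        refine Filter.liminf_congr ?_
        filter_upwards [Filter.eventually_gt_atTop 0] with N hN
        have hN' : (0 : ℝ) < (N : ℝ)⁻¹ := inv_pos.2 (Nat.cast_pos.2 hN)
        rw [lintegral_const_mul _ (measurable_tupKer_apply h (hSm N)), ← meanTup_apply _ _ (hSm N),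
          meanTup_smul μ hinv hh hhn hl hA hN', ← mul_assoc, ← ENNReal.ofReal_mul (by positivity),
          mul_inv_cancel₀ (by positivity), ENNReal.ofReal_one, one_mul]
    _ = _ := Filter.liminf_const _

lemma convex_toLp_norm_le (R : ℝ) : Convex ℝ {x : Fin n → ℝ | ‖WithLp.toLp 2 x‖ ≤ R} := by
  intro x hx y hy a b ha hb hab
  have h := convex_closedBall (0 : EuclideanSpace ℝ (Fin n)) R (mem_closedBall_zero_iff.2 hx)
    (mem_closedBall_zero_iff.2 hy) ha hb hab
  exact mem_closedBall_zero_iff.1 h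

lemma isBounded_tupBall (R : ℝ) : Bornology.IsBounded (tupBall n h R) := by
  refine Bornology.IsBounded.pi fun _ => isBounded_iff_forall_norm_le.2 ⟨|R|, fun x hx => ?_⟩
  refine (pi_norm_le_iff_of_nonneg (abs_nonneg R)).2 fun i => ?_
  exact ((PiLp.norm_apply_le (WithLp.toLp 2 x) i).trans hx).trans (le_abs_self R)

lemma convex_tupBall (R : ℝ) : Convex ℝ (tupBall n h R) :=
  convex_pi fun _ _ => convex_toLp_norm_le R

lemma volume_pow_le_meanTup (μ : Measure (LatSpace n)) [IsProbabilityMeasure μ]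
    (hinv : ∀ a : SLR n, μ.map (rTranslate n a) = μ) (hh : 0 < h) (hhn : h < n) (R : ℝ) :
    ∃ ι : Fin h ↪ Fin n, volume {x : Fin n → ℝ | ‖WithLp.toLp 2 x‖ ≤ R} ^ h
      ≤ meanTup μ h (tupGood ι ∩ tupBall n h R) := by
  have hl : ∀ b : Fin h, Fin.castLEEmb hhn.le b ≠ (⟨h, hhn⟩ : Fin n) := fun b hb =>
    b.2.ne (congrArg Fin.val hb)
  refine ⟨Fin.castLEEmb hhn.le, ?_⟩
  have key := volume_le_meanTup μ hinv hh hhn hl (measurableSet_tupBall h R) (isBounded_tupBall R)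
    ((convex_tupBall R).addHaar_frontier volume)
  refine le_trans (le_of_eq ?_) key
  rw [tupBall, volume_pi_pi, Finset.prod_const, Finset.card_univ, Fintype.card_fin]

end MeanMeasureLowerBound

section FactorialMoments

/-- Powers in terms of falling factorials. -/
lemma pow_eq_sum_stirlingSecond (x k : ℕ) :
    x ^ k = ∑ j ∈ Finset.range (k + 1), Nat.stirlingSecond k j * x.descFactorial j := by
  induction k with
  | zero => simp
  | succ k ih =>
    have hx : ∀ j, x * x.descFactorial j = x.descFactorial (j + 1) + j * x.descFactorial j := by
      intro j
      rw [Nat.descFactorial_succ]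
      rcases le_or_gt j x with hj | hj
      · obtain ⟨d, rfl⟩ := Nat.exists_eq_add_of_le hj
        rw [Nat.add_sub_cancel_left]
        ring
      · simp [Nat.descFactorial_eq_zero_iff_lt.2 hj]
    rw [Finset.sum_range_succ', Nat.stirlingSecond_succ_zero, zero_mul, add_zero]
    simp only [Nat.stirlingSecond_succ_succ]
    have h2 := Finset.sum_range_succ'
      (fun j => Nat.stirlingSecond k j * (j * x.descFactorial j)) (k + 1)
    rw [Finset.sum_range_succ, Nat.stirlingSecond_eq_zero_of_lt k.lt_succ_self] at h2
    rw [pow_succ, ih, Finset.sum_mul]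
    calc ∑ j ∈ Finset.range (k + 1), Nat.stirlingSecond k j * x.descFactorial j * x
        = ∑ j ∈ Finset.range (k + 1), (Nat.stirlingSecond k j * (j * x.descFactorial j)
            + Nat.stirlingSecond k j * x.descFactorial (j + 1)) :=
          Finset.sum_congr rfl fun j _ => by
            rw [mul_assoc, mul_comm _ x, hx, mul_add, add_comm]
      _ = _ := by
          simp only [zero_mul, mul_zero, add_zero] at h2
          rw [Finset.sum_add_distrib, h2, ← Finset.sum_add_distrib]
          exact Finset.sum_congr rfl fun j _ => by ring

lemma hasSum_descFactorial_mul (x : ℝ) (j : ℕ) :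
    HasSum (fun i : ℕ => (i.descFactorial j : ℝ) * x ^ i / (i)!) (x ^ j * Real.exp x) := by
  have h1 := (NormedSpace.expSeries_div_hasSum_exp x).mul_left (x ^ j)
  rw [← Real.exp_eq_exp_ℝ] at h1
  rw [← hasSum_nat_add_iff' j, Finset.sum_eq_zero, sub_zero]
  · refine h1.congr_fun ?_
    intro i
    have h3 : ((i + j).descFactorial j : ℝ) * (i)! = (i + j)! := by
      have := Nat.factorial_mul_descFactorial (Nat.le_add_left j i)
      rw [Nat.add_sub_cancel] at this
      rw [← this]
      push_cast
      ring
    have h4 : ((i)! : ℝ) ≠ 0 := by positivity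
    have h5 : ((i + j)! : ℝ) ≠ 0 := by positivity
    rw [← h3, pow_add]
    have h6 : ((i + j).descFactorial j : ℝ) ≠ 0 := left_ne_zero_of_mul (h3 ▸ h5)
    field_simp
  · intro i hi
    rw [Nat.descFactorial_eq_zero_iff_lt.2 (Finset.mem_range.1 hi)]
    simp

/-- The moments of the Poisson distribution. -/
lemma exp_neg_mul_tsum_pow (x : ℝ) (k : ℕ) :
    Real.exp (-x) * ∑' i : ℕ, (i : ℝ) ^ k * x ^ i / (i)!
      = ∑ j ∈ Finset.range (k + 1), (Nat.stirlingSecond k j : ℝ) * x ^ j := by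
  have h := hasSum_sum (s := Finset.range (k + 1)) fun j _ =>
    (hasSum_descFactorial_mul x j).mul_left (Nat.stirlingSecond k j : ℝ)
  have e : (fun i : ℕ => (i : ℝ) ^ k * x ^ i / (i)!) = fun i => ∑ j ∈ Finset.range (k + 1),
      (Nat.stirlingSecond k j : ℝ) * ((i.descFactorial j : ℝ) * x ^ i / (i)!) := by
    funext i
    rw [← Nat.cast_pow, pow_eq_sum_stirlingSecond, Nat.cast_sum, Finset.sum_mul, Finset.sum_div]
    refine Finset.sum_congr rfl fun j _ => ?_
    push_cast
    ring
  rw [e, h.tsum_eq, Finset.mul_sum]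
  refine Finset.sum_congr rfl fun j _ => ?_
  rw [mul_left_comm, mul_left_comm _ (x ^ j), ← Real.exp_add, neg_add_cancel, Real.exp_zero, mul_one]

/-- Tuples of elements of `±P` with entries distinct up to sign. -/
lemma encard_tuples_le {α : Type*} [AddGroup α] (P : Finset α) (h : ℕ) :
    {m : Fin h → α | (∀ a, m a ∈ P ∨ -m a ∈ P) ∧
        ∀ a b, a ≠ b → m a ≠ m b ∧ m a ≠ -m b}.encard
      ≤ (2 ^ h * P.card.descFactorial h : ℕ) := by
  let F : (Fin h → Bool) × (Fin h ↪ P) → Fin h → α :=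
    fun p a => if p.1 a then (p.2 a : α) else -(p.2 a : α)
  have hsub : {m : Fin h → α | (∀ a, m a ∈ P ∨ -m a ∈ P) ∧
      ∀ a b, a ≠ b → m a ≠ m b ∧ m a ≠ -m b} ⊆ F '' Set.univ := by
    rintro m ⟨hP, hne⟩
    let e : Fin h → P := fun a =>
      if ha : m a ∈ P then ⟨m a, ha⟩ else ⟨-m a, (hP a).resolve_left ha⟩
    have he : ∀ a, (e a : α) = if m a ∈ P then m a else -m a := fun a => by
      by_cases ha : m a ∈ P <;> simp [e, ha]
    have hinj : Function.Injective e := by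
      intro a b hab
      by_contra hab'
      have h1 := congrArg Subtype.val hab
      obtain ⟨h2, h3⟩ := hne a b hab'
      have h4 := (hne b a (Ne.symm hab')).2
      rw [he, he] at h1
      split_ifs at h1
      · exact h2 h1
      · exact h3 h1
      · exact h4 h1.symm
      · exact h2 (neg_injective h1)
    refine ⟨⟨fun a => decide (m a ∈ P), ⟨e, hinj⟩⟩, trivial, ?_⟩
    funext a
    by_cases ha : m a ∈ P <;> simp [F, he, ha]
  refine (Set.encard_le_encard hsub).trans ((Set.encard_image_le _ _).trans (le_of_eq ?_))
  rw [Set.encard_univ, ENat.card_eq_coe_fintype_card, Fintype.card_prod, Fintype.card_embedding_eq]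
  simp

end FactorialMoments

section LowerBound

variable {n : ℕ}

/-- The coefficient vectors of the nonzero points, up to sign, of `ℤ^n g` in a ball. -/
noncomputable def halfPts (g : SLR n) (R : ℝ) : Finset (Fin n → ℤ) :=
  (finite_rowMap_le g R).toFinset.filter fun m => 0 < toLex m

lemma mem_halfPts {g : SLR n} {R : ℝ} {m : Fin n → ℤ} :
    m ∈ halfPts g R ↔ ‖rowMap g.1 (intVec m)‖ ≤ R ∧ 0 < toLex m := by
  simp [halfPts]

lemma norm_rowMap_neg (g : SLR n) (m : Fin n → ℤ) :
    ‖rowMap g.1 (intVec (-m))‖ = ‖rowMap g.1 (intVec m)‖ := by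
  rw [map_neg, map_neg, norm_neg]

lemma neg_mem_halfPts {g : SLR n} {R : ℝ} {m : Fin n → ℤ} :
    -m ∈ halfPts g R ↔ ‖rowMap g.1 (intVec m)‖ ≤ R ∧ toLex m < 0 := by
  rw [mem_halfPts, norm_rowMap_neg, toLex_neg, Left.neg_pos_iff]

lemma mem_halfPts_or_neg_mem {g : SLR n} {R : ℝ} {m : Fin n → ℤ}
    (hm : ‖rowMap g.1 (intVec m)‖ ≤ R) (h0 : m ≠ 0) : m ∈ halfPts g R ∨ -m ∈ halfPts g R := by
  rw [mem_halfPts, neg_mem_halfPts]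
  rcases lt_trichotomy (toLex m) 0 with h | h | h
  · exact Or.inr ⟨hm, h⟩
  · exact absurd h h0
  · exact Or.inl ⟨hm, h⟩

lemma card_erase_zero (g : SLR n) (R : ℝ) :
    ((finite_rowMap_le g R).toFinset.erase 0).card = 2 * (halfPts g R).card := by
  have e : (finite_rowMap_le g R).toFinset.erase 0
      = halfPts g R ∪ (halfPts g R).map (Equiv.neg _).toEmbedding := by
    ext m
    simp only [Finset.mem_erase, Set.Finite.mem_toFinset, Set.mem_ofPred_eq, Finset.mem_union,
      Finset.mem_map_equiv, Equiv.neg_symm, Equiv.neg_apply]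
    refine ⟨fun hm => mem_halfPts_or_neg_mem hm.2 hm.1, ?_⟩
    rw [mem_halfPts, neg_mem_halfPts]
    rintro (⟨h1, h2⟩ | ⟨h1, h2⟩)
    · exact ⟨fun h => h2.ne' (congrArg toLex h), h1⟩
    · exact ⟨fun h => h2.ne (congrArg toLex h), h1⟩
  rw [e, Finset.card_union_of_disjoint, Finset.card_map, two_mul]
  rw [Finset.disjoint_left]
  intro m h1 h2
  rw [Finset.mem_map_equiv, Equiv.neg_symm, Equiv.neg_apply, neg_mem_halfPts] at h2
  exact lt_asymm (mem_halfPts.1 h1).2 h2.2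

lemma latCount_matLat_eq (g : SLR n) {R : ℝ} (hR : 0 ≤ R) :
    latCount (matLat g.1) R = 2 * (halfPts g R).card + 1 := by
  rw [latCount_matLat, Set.ncard_eq_toFinset_card _ (finite_rowMap_le g R), ← card_erase_zero,
    Finset.card_erase_add_one]
  simpa using hR

/-- The number of nonzero lattice vectors up to sign in a ball. -/
noncomputable def halfCount (R : ℝ) (x : LatSpace n) : ℕ := (latCount (latOf x) R - 1) / 2

lemma halfCount_latMk (g : SLR n) {R : ℝ} (hR : 0 ≤ R) :
    halfCount R (latMk n g) = (halfPts g R).card := by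
  rw [halfCount, latOf_latMk, latCount_matLat_eq g hR]
  lia

lemma measurable_halfCount (R : ℝ) : Measurable (halfCount (n := n) R) := by
  have h : Measurable fun x : LatSpace n => latCount (latOf x) R := by
    refine measurable_to_countable' fun y => ?_
    have e : (fun x : LatSpace n => latCount (latOf x) R) ⁻¹' {y}
        = (fun x : LatSpace n => (latCount (latOf x) R : ℝ)) ⁻¹' {(y : ℝ)} := by
      ext x
      simp
    rw [e]
    exact measurable_latCount R (measurableSet_singleton _)
  exact (measurable_from_top (f := fun c : ℕ => (c - 1) / 2)).comp h

lemma tsum_indicator_ball (g : SLR n) {R : ℝ} (hR : 0 ≤ R) :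
    ∑' m : {m : Fin n → ℤ // m ≠ 0}, {x : Fin n → ℝ | ∑ i, (x i) ^ 2 ≤ R ^ 2}.indicator
      (fun _ => (1 : ℝ)) (Matrix.vecMul (fun i => ((m : Fin n → ℤ) i : ℝ)) g.1)
      = 2 * (halfPts g R).card := by
  set B : Set (Fin n → ℝ) := {x : Fin n → ℝ | ∑ i, (x i) ^ 2 ≤ R ^ 2} with hB
  have hmem : ∀ m : Fin n → ℤ,
      intVec m ᵥ* g.1 ∈ B ↔ ‖rowMap g.1 (intVec m)‖ ≤ R := fun m => by
    rw [← abs_of_nonneg hR, ← abs_norm, ← sq_le_sq, EuclideanSpace.norm_sq_eq]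
    simp [hB, rowMap_apply]
  have h1 := tsum_subtype {m : Fin n → ℤ | m ≠ 0}
    fun m => B.indicator (fun _ => (1 : ℝ)) (intVec m ᵥ* g.1)
  refine h1.trans ?_
  rw [tsum_eq_sum (s := (finite_rowMap_le g R).toFinset.erase 0)]
  · rw [Finset.sum_congr rfl (g := fun _ => (1 : ℝ)), Finset.sum_const, card_erase_zero]
    · simp
    · intro m hm
      rw [Finset.mem_erase, Set.Finite.mem_toFinset] at hm
      rw [Set.indicator_of_mem (show m ∈ {m : Fin n → ℤ | m ≠ 0} from hm.1),
        Set.indicator_of_mem ((hmem m).2 hm.2)]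
  · intro m hm
    rw [Finset.mem_erase, Set.Finite.mem_toFinset, not_and_or, not_not] at hm
    rcases hm with rfl | hm
    · exact Set.indicator_of_notMem (fun h : (0 : Fin n → ℤ) ≠ 0 => h rfl) _
    · have h2 : B.indicator (fun _ => (1 : ℝ)) (intVec m ᵥ* g.1) = 0 :=
        Set.indicator_of_notMem (fun h => hm ((hmem m).1 h)) _
      by_cases h0 : m ∈ {m : Fin n → ℤ | m ≠ 0}
      · rw [Set.indicator_of_mem h0, h2]
      · exact Set.indicator_of_notMem h0 _

/-- The rows of a tuple in `tupGood ι` are linearly independent. -/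
lemma linearIndependent_of_mem_tupGood {h : ℕ} {ι : Fin h ↪ Fin n} {x : Fin h → Fin n → ℝ}
    (hx : x ∈ tupGood ι) : LinearIndependent ℝ x :=
  LinearIndependent.of_comp (LinearMap.funLeft ℝ ℝ ι)
    (linearIndependent_rows_of_det_ne_zero (A := tupBlock ι x) hx)

lemma tupKer_tupGood_le {h : ℕ} (ι : Fin h ↪ Fin n) {R : ℝ} (hR : 0 ≤ R) (x : LatSpace n) :
    tupKer h x (tupGood ι ∩ tupBall n h R)
      ≤ ((2 ^ h * (halfCount R x).descFactorial h : ℕ) : ENNReal) := by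
  obtain ⟨g, rfl⟩ := latMk_surjective x
  rw [tupKer_latMk, halfCount_latMk g hR,
    tupMeas_apply _ ((measurableSet_tupGood ι).inter (measurableSet_tupBall h R))]
  suffices hsub : {m : Fin h → Fin n → ℤ | tupMul (fun a => intVec (m a)) g.1
      ∈ tupGood ι ∩ tupBall n h R} ⊆ {m | (∀ a, m a ∈ halfPts g R ∨ -m a ∈ halfPts g R) ∧
        ∀ a b, a ≠ b → m a ≠ m b ∧ m a ≠ -m b} from
    mod_cast ENat.toENNReal_le.2
      ((Set.encard_le_encard hsub).trans (encard_tuples_le (halfPts g R) h))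
  rintro m ⟨hm, hmR⟩
  have hli := linearIndependent_of_mem_tupGood hm
  refine ⟨fun a => mem_halfPts_or_neg_mem (hmR a trivial) fun h0 => hli.ne_zero a ?_,
    fun a b hab => ⟨fun h2 => hab (hli.injective ?_), fun h2 => ?_⟩⟩
  · simp [tupMul, h0]
  · simp only [tupMul, h2]
  · have h3 := Fintype.linearIndependent_iff.1 hli (Pi.single a 1 + Pi.single b 1) ?_ a
    · simp [hab] at h3
    · simp [add_smul, Finset.sum_add_distrib, Pi.single_apply, tupMul, h2, neg_vecMul]

variable (μ : Measure (LatSpace n)) [IsProbabilityMeasure μ]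
  (hinv : ∀ a : SLR n, μ.map (rTranslate n a) = μ)

include hinv in
lemma integrable_of_le_halfCount_pow {k : ℕ} (hk : 0 < k) (hkn : k < n) {R : ℝ} (hR : 0 < R)
    {F : ℕ → ℕ} (hF : ∀ c, F c ≤ c ^ k) :
    Integrable (fun x => (F (halfCount R x) : ℝ)) μ := by
  refine (integrable_latCount_pow hk hkn μ hinv hR).mono'
    ((measurable_from_top (f := fun c : ℕ => (F c : ℝ))).comp
      (measurable_halfCount R)).aestronglyMeasurable (Filter.Eventually.of_forall fun x => ?_)
  rw [Real.norm_eq_abs, Nat.abs_cast]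
  have h1 : halfCount R x ≤ latCount (latOf x) R := by rw [halfCount]; lia
  exact_mod_cast (hF _).trans (Nat.pow_le_pow_left h1 k)

include hinv in
lemma pow_le_integral_descFactorial {h : ℕ} (hh : 0 < h) (hhn : h < n) {R : ℝ} (hR : 0 < R) :
    (volume.real {x : Fin n → ℝ | ‖WithLp.toLp 2 x‖ ≤ R} / 2) ^ h
      ≤ ∫ x, ((halfCount R x).descFactorial h : ℝ) ∂μ := by
  obtain ⟨ι, hι⟩ := volume_pow_le_meanTup μ hinv hh hhn R
  have hInt := integrable_of_le_halfCount_pow μ hinv hh hhn hR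
    (F := fun c => c.descFactorial h) fun c => Nat.descFactorial_le_pow c h
  rw [meanTup_apply _ _ ((measurableSet_tupGood ι).inter (measurableSet_tupBall h R))] at hι
  have h1 := hι.trans (lintegral_mono fun x => tupKer_tupGood_le ι hR.le x)
  have h2 : ∀ x : LatSpace n, ((2 ^ h * (halfCount R x).descFactorial h : ℕ) : ENNReal)
      = ENNReal.ofReal (2 ^ h * ((halfCount R x).descFactorial h : ℝ)) := fun x => by
    rw [← ENNReal.ofReal_natCast]
    push_cast
    rfl
  simp only [h2] at h1
  rw [← ofReal_integral_eq_lintegral_ofReal (hInt.const_mul _)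
    (Filter.Eventually.of_forall fun x => by positivity), integral_const_mul] at h1
  have h3 := ENNReal.toReal_le_of_le_ofReal
    (mul_nonneg (by positivity) (integral_nonneg fun x => by positivity)) h1
  rw [ENNReal.toReal_pow] at h3
  rw [div_pow, div_le_iff₀ (by positivity), mul_comm]
  exact h3

end LowerBound

/-- **Theorem (Rogers, lower moment bound).** Let `n ≥ 2`, `r > 0`, let `ρ` be the
characteristic function of the closed Euclidean ball of radius `r` about the origin in
`ℝ^n`, with volume `V(r)`, and let `k` be a positive integer with `n ≥ ⌊k²/4⌋ + 3`.
Then the `k`-th moment of the Poisson distribution with mean `V(r)/2`,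
`e^{−V(r)/2} Σ_{i=0}^∞ i^k (V(r)/2)^i / i!`, is at most
`∫_{X_n} ((1/2) Σ_{x ∈ L∖{0}} ρ(x))^k dμ_n(L)`. -/
theorem stmt18 (n : ℕ) (hn : 2 ≤ n) (r : ℝ) (hr : 0 < r) (k : ℕ) (hk : 0 < k)
    (hnk : k ^ 2 / 4 + 3 ≤ n)
    (μ : MeasureTheory.Measure (LatSpace n)) [MeasureTheory.IsProbabilityMeasure μ]
    (hinv : ∀ a : SLR n, μ.map (rTranslate n a) = μ)
    (B : Set (Fin n → ℝ)) (hB : B = {x : Fin n → ℝ | ∑ i, (x i) ^ 2 ≤ r ^ 2})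
    (V : ℝ) (hV : V = (MeasureTheory.volume B).toReal)
    (f : LatSpace n → ℝ)
    (hf : ∀ g : SLR n, f (latMk n g) =
      ((1 / 2) * ∑' m : {m : Fin n → ℤ // m ≠ 0},
        B.indicator (fun _ => (1 : ℝ))
          (Matrix.vecMul (fun i => ((m : Fin n → ℤ) i : ℝ))
            (g : Matrix (Fin n) (Fin n) ℝ))) ^ k) :
    Real.exp (-(V / 2)) * ∑' i : ℕ, (i : ℝ) ^ k * (V / 2) ^ i / (i)!
      ≤ ∫ x, f x ∂μ := by
  have hkn : k < n := by
    have : 4 * k ≤ k ^ 2 + 4 := by nlinarith [sq_nonneg ((k : ℤ) - 2)]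
    lia
  have hV' : V = volume.real {x : Fin n → ℝ | ‖WithLp.toLp 2 x‖ ≤ r} := by
    rw [hV, hB, measureReal_def]
    congr 2
    ext x
    rw [Set.mem_ofPred_eq, Set.mem_ofPred_eq, ← abs_of_pos hr, ← abs_norm, ← sq_le_sq,
      EuclideanSpace.norm_sq_eq]
    simp
  have hfx : ∀ x, f x = ((halfCount r x ^ k : ℕ) : ℝ) := fun x => by
    obtain ⟨g, rfl⟩ := latMk_surjective x
    rw [hf, hB, tsum_indicator_ball g hr.le, halfCount_latMk g hr.le]
    push_cast
    ring
  simp only [hfx, pow_eq_sum_stirlingSecond, Nat.cast_sum, Nat.cast_mul]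
  rw [exp_neg_mul_tsum_pow, integral_finsetSum]
  · refine Finset.sum_le_sum fun j hj => ?_
    rw [integral_const_mul]
    refine mul_le_mul_of_nonneg_left ?_ (by positivity)
    rcases Nat.eq_zero_or_pos j with rfl | hj0
    · simp
    · rw [hV']
      exact pow_le_integral_descFactorial μ hinv hj0
        ((Nat.lt_succ_iff.1 (Finset.mem_range.1 hj)).trans_lt hkn) hr
  · intro j hj
    refine Integrable.const_mul ?_ _
    rcases Nat.eq_zero_or_pos j with rfl | hj0
    · simp
    · exact integrable_of_le_halfCount_pow μ hinv hj0
        ((Nat.lt_succ_iff.1 (Finset.mem_range.1 hj)).trans_lt hkn) hr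
        (F := fun c => c.descFactorial j) fun c => Nat.descFactorial_le_pow c j
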